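/- arXiv:1405.2527 — 5 statements merged into one kernel-verified Lean document; each statement's English description precedes it below -/
import Mathlib

section
/- For any compact Hausdorff space K, the space P(K×K) of Radon probability measures on K×K with the weak* topology has countable tightness if and only if the Banach space C(K×K) of continuous real-valued functions on K×K with the supremum norm has property (C) of Corson. -/
open MeasureTheory Set

noncomputable section

/-- A topological space has *countable tightness* if whenever `x` lies in the closure of a
set `A`, there is a countable `B ⊆ A` with `x` in the closure of `B`. -/
def CountablyTight (X : Type*) [TopologicalSpace X] : Prop :=
  ∀ (A : Set X) (x : X), x ∈ closure A →
    ∃ B ⊆ A, B.Countable ∧ x ∈ closure B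

/-- `P(K)`: the space of Radon probability measures on `K`, i.e. Borel probability
measures which are inner regular with respect to compact sets. -/
def RadonProb (K : Type*) [TopologicalSpace K] : Type _ :=
  { μ : @Measure K (borel K) //
      @IsProbabilityMeasure K (borel K) μ ∧ @Measure.InnerRegular K (borel K) _ μ }

/-- The weak* topology on `RadonProb K`: the coarsest topology making
`μ ↦ ∫ g dμ` continuous for every continuous `g : K → ℝ`. -/
instance (K : Type*) [TopologicalSpace K] : TopologicalSpace (RadonProb K) :=
  TopologicalSpace.induced
    (fun (μ : RadonProb K) (g : C(K, ℝ)) => ∫ x, g x ∂μ.1) inferInstance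

/-- A measure has *countable (Maharam) type* if there is a countable family `𝒞` of measurable
sets such that every measurable set can be approximated in measure by members of `𝒞`. -/
def HasCountableType {K : Type*} {m : MeasurableSpace K} (μ : Measure K) : Prop :=
  ∃ 𝒞 : Set (Set K), 𝒞.Countable ∧ (∀ C ∈ 𝒞, MeasurableSet C) ∧
    ∀ B : Set K, MeasurableSet B → ∀ ε : ENNReal, 0 < ε → ∃ C ∈ 𝒞, μ (symmDiff B C) < ε

/-- The *Maharam type* of a measure: the least cardinality of a family `𝒞` of measurable sets
such that every measurable set can be approximated in measure by members of `𝒞`. -/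
def maharamType {K : Type*} {m : MeasurableSpace K} (μ : Measure K) : Cardinal :=
  sInf {κ : Cardinal | ∃ 𝒞 : Set (Set K), Cardinal.mk 𝒞 = κ ∧ (∀ C ∈ 𝒞, MeasurableSet C) ∧
    ∀ B : Set K, MeasurableSet B → ∀ ε : ENNReal, 0 < ε → ∃ C ∈ 𝒞, μ (symmDiff B C) < ε}

/-- `μ` is homogeneous of Maharam type `ω₁`: its Maharam type is `ℵ₁` and the Maharam type of
its restriction to every measurable set of positive measure is `ℵ₁`. -/
def IsHomogeneousOmega1 {K : Type*} {m : MeasurableSpace K} (μ : Measure K) : Prop :=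
  maharamType μ = Cardinal.aleph 1 ∧
    ∀ B : Set K, MeasurableSet B → 0 < μ B →
      maharamType (μ.restrict B) = Cardinal.aleph 1

/-- A finitely additive probability measure on an algebra `𝒮` of subsets. -/
def IsFinAddProb {α : Type*} (𝒮 : Set (Set α)) (ν : Set α → ℝ) : Prop :=
  (∀ S ∈ 𝒮, 0 ≤ ν S) ∧ ν Set.univ = 1 ∧
    ∀ S ∈ 𝒮, ∀ T ∈ 𝒮, Disjoint S T → ν (S ∪ T) = ν S + ν T

/-- `𝒜 ⊗ ℬ`: the algebra of subsets of `K × K` generated by rectangles `A ×ˢ B` with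
`A ∈ 𝒜`, `B ∈ ℬ`. -/
def prodAlg {K : Type*} (𝒜 ℬ : Set (Set K)) : Set (Set (K × K)) :=
  MeasureTheory.generateSetAlgebra {S | ∃ A ∈ 𝒜, ∃ B ∈ ℬ, S = A ×ˢ B}

/-- The rectangle algebra `𝓡 = Bor(K) ⊗ Bor(K)` on `K × K`. -/
def rectAlgebra (K : Type*) [TopologicalSpace K] : Set (Set (K × K)) :=
  prodAlg {B : Set K | MeasurableSet[borel K] B} {B : Set K | MeasurableSet[borel K] B}

/-- `ν` (a set function on `K × K`) has both marginals equal to `μ`. -/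
def HasMarginals {K : Type*} [TopologicalSpace K] (ν : Set (K × K) → ℝ)
    (μ : @Measure K (borel K)) : Prop :=
  ∀ B : Set K, MeasurableSet[borel K] B →
    ν (B ×ˢ (Set.univ : Set K)) = (μ B).toReal ∧
    ν ((Set.univ : Set K) ×ˢ B) = (μ B).toReal

/-- Finite convex combinations of members of a set of Radon probability measures. -/
def ConvexCombinations {X : Type*} [TopologicalSpace X] (N : Set (RadonProb X)) :
    Set (RadonProb X) :=
  {ν | ∃ (n : ℕ) (t : Fin n → NNReal) (μs : Fin n → RadonProb X),
      (∀ i, μs i ∈ N) ∧ (∑ i, t i) = 1 ∧ ν.1 = ∑ i, ((t i : ENNReal) • (μs i).1)}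

/-- Property (C) of Corson: every family of closed convex sets with the countable
intersection property has nonempty intersection. -/
def PropertyC (X : Type*) [NormedAddCommGroup X] [NormedSpace ℝ X] : Prop :=
  ∀ 𝒞 : Set (Set X), (∀ C ∈ 𝒞, IsClosed C ∧ Convex ℝ C) →
    (∀ 𝒟 ⊆ 𝒞, 𝒟.Countable → (⋂₀ 𝒟).Nonempty) → (⋂₀ 𝒞).Nonempty

/-- Finite unions of closed rectangles in `K × K`. -/
def closedRectUnions (K : Type*) [TopologicalSpace K] : Set (Set (K × K)) :=
  {L | ∃ (n : ℕ) (F F' : Fin n → Set K), (∀ i, IsClosed (F i)) ∧ (∀ i, IsClosed (F' i)) ∧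
    L = ⋃ i, F i ×ˢ F' i}


/-! ### Positive functionals -/

/-- positive linear functional, as a plain function -/
structure IsPos {L : Type*} [TopologicalSpace L] (φ : C(L, ℝ) → ℝ) : Prop where
  add : ∀ f g, φ (f + g) = φ f + φ g
  smul : ∀ (c : ℝ) f, φ (c • f) = c * φ f
  nonneg : ∀ f, 0 ≤ f → 0 ≤ φ f

namespace IsPos

variable {L : Type*} [TopologicalSpace L] {φ : C(L, ℝ) → ℝ}

/-- the linear map -/
def lin (h : IsPos φ) : C(L, ℝ) →ₗ[ℝ] ℝ where
  toFun := φ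
  map_add' := h.add
  map_smul' := by intro c f; simpa using h.smul c f

lemma neg (h : IsPos φ) (f) : φ (-f) = - φ f := h.lin.map_neg f
lemma zero (h : IsPos φ) : φ 0 = 0 := h.lin.map_zero
lemma sub (h : IsPos φ) (f g) : φ (f - g) = φ f - φ g := h.lin.map_sub f g
lemma sum (h : IsPos φ) {ι : Type*} (s : Finset ι) (f : ι → C(L, ℝ)) :
    φ (∑ i ∈ s, f i) = ∑ i ∈ s, φ (f i) := map_sum h.lin f s

lemma mono (h : IsPos φ) {f g : C(L, ℝ)} (hfg : ∀ x, f x ≤ g x) : φ f ≤ φ g := by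
  have := h.nonneg (g - f) (by intro x; simpa using hfg x)
  rw [h.sub] at this; linarith

lemma abs_le (h : IsPos φ) (f : C(L, ℝ)) : |φ f| ≤ φ |f| := by
  rw [abs_le']
  refine ⟨h.mono fun x => ?_, ?_⟩
  · simpa using le_abs_self (f x)
  · rw [← h.neg]; exact h.mono fun x => by simpa using neg_le_abs (f x)

lemma le_of_le_const (h : IsPos φ) {f : C(L, ℝ)} {c : ℝ} (hf : ∀ x, f x ≤ c) : φ f ≤ c * φ 1 := by
  rw [← h.smul]; exact h.mono fun x => by simpa using hf x

lemma abs_le_norm [CompactSpace L] (h : IsPos φ) (f : C(L, ℝ)) : |φ f| ≤ ‖f‖ * φ 1 :=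
  (h.abs_le f).trans (h.le_of_le_const fun x => by simpa using f.norm_coe_le_norm x)

lemma one_nonneg (h : IsPos φ) : 0 ≤ φ 1 := h.nonneg 1 (by intro x; simp)

lemma continuous [CompactSpace L] (h : IsPos φ) : Continuous φ := by
  have : ∀ f, ‖h.lin f‖ ≤ φ 1 * ‖f‖ := fun f => by
    rw [mul_comm]; exact h.abs_le_norm f
  exact (h.lin.mkContinuous _ this).continuous

end IsPos

/-- set of states -/
def St (L : Type*) [TopologicalSpace L] : Set (C(L, ℝ) → ℝ) := {φ | IsPos φ ∧ φ 1 = 1}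

/-- set of positive functionals of norm at most one -/
def P1 (L : Type*) [TopologicalSpace L] : Set (C(L, ℝ) → ℝ) := {φ | IsPos φ ∧ φ 1 ≤ 1}

lemma St_sub_P1 (L : Type*) [TopologicalSpace L] : St L ⊆ P1 L := fun _ h => ⟨h.1, h.2.le⟩

lemma isClosed_isPos (L : Type*) [TopologicalSpace L] : IsClosed {φ : C(L, ℝ) → ℝ | IsPos φ} := by
  have : {φ : C(L, ℝ) → ℝ | IsPos φ} =
    (⋂ f, ⋂ g, {φ | φ (f + g) = φ f + φ g}) ∩ (⋂ c : ℝ, ⋂ f, {φ | φ (c • f) = c * φ f}) ∩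
      (⋂ f, ⋂ (_ : 0 ≤ f), {φ | 0 ≤ φ f}) := by
    ext φ
    simp only [mem_ofPred_eq, mem_inter_iff, mem_iInter]
    exact ⟨fun h => ⟨⟨h.add, h.smul⟩, h.nonneg⟩, fun h => ⟨h.1.1, h.1.2, h.2⟩⟩
  rw [this]
  refine (IsClosed.inter (isClosed_iInter fun f => isClosed_iInter fun g => ?_)
    (isClosed_iInter fun c => isClosed_iInter fun f => ?_)).inter
      (isClosed_iInter fun f => isClosed_iInter fun g => ?_)
  · exact isClosed_eq (continuous_apply _) (by fun_prop)
  · exact isClosed_eq (continuous_apply _) (by fun_prop)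
  · exact isClosed_le continuous_const (continuous_apply _)

lemma isCompact_P1 (L : Type*) [TopologicalSpace L] [CompactSpace L] : IsCompact (P1 L) := by
  have h1 : IsCompact (Set.univ.pi fun f : C(L, ℝ) => Icc (-‖f‖) ‖f‖) :=
    isCompact_univ_pi fun f => isCompact_Icc
  refine h1.of_isClosed_subset ?_ ?_
  · exact (isClosed_isPos L).inter (isClosed_le (continuous_apply 1) continuous_const)
  · intro φ hφ f _
    rw [mem_Icc, ← _root_.abs_le]
    refine (hφ.1.abs_le_norm f).trans ?_
    nlinarith [hφ.2, norm_nonneg f]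

lemma isCompact_St (L : Type*) [TopologicalSpace L] [CompactSpace L] : IsCompact (St L) := by
  refine (isCompact_P1 L).of_isClosed_subset ?_ (St_sub_P1 L)
  exact (isClosed_isPos L).inter (isClosed_eq (continuous_apply 1) continuous_const)

lemma mem_closure_fun {ι : Type*} {A : Set (ι → ℝ)} {x : ι → ℝ} :
    x ∈ closure A ↔ ∀ (J : Finset ι) (ε : ℝ), 0 < ε → ∃ a ∈ A, ∀ j ∈ J, |a j - x j| < ε := by
  constructor
  · intro h J ε hε
    have ho : IsOpen (Set.pi (J : Set ι) fun j => Metric.ball (x j) ε) :=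
      isOpen_set_pi J.finite_toSet fun j _ => Metric.isOpen_ball
    obtain ⟨a, ha, haA⟩ := mem_closure_iff.1 h _ ho (fun j _ => Metric.mem_ball_self hε)
    exact ⟨a, haA, fun j hj => by simpa [Real.dist_eq] using ha j hj⟩
  · intro h
    rw [mem_closure_iff_nhds]
    intro t ht
    rw [nhds_pi, Filter.mem_pi'] at ht
    obtain ⟨J, V, hV, hVt⟩ := ht
    have : ∀ j, ∃ ε > 0, Metric.ball (x j) ε ⊆ V j := fun j => Metric.mem_nhds_iff.1 (hV j)
    choose e he heV using this
    obtain ⟨ε, hε, hle⟩ : ∃ ε > 0, ∀ j ∈ J, ε ≤ e j := by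
      by_cases hJ : J.Nonempty
      · obtain ⟨j, hj, hmin⟩ := J.exists_min_image e hJ
        exact ⟨e j, he j, hmin⟩
      · exact ⟨1, one_pos, fun j hj => (hJ ⟨j, hj⟩).elim⟩
    obtain ⟨a, haA, ha⟩ := h J ε hε
    exact ⟨a, hVt fun j hj => heV j (by
      rw [Metric.mem_ball, Real.dist_eq]; exact (ha j hj).trans_le (hle j hj)), haA⟩

/-- countable tightness of a set in an ambient space -/
def TightSet {Y : Type*} [TopologicalSpace Y] (S : Set Y) : Prop :=
  ∀ A ⊆ S, ∀ x ∈ S, x ∈ closure A → ∃ B ⊆ A, B.Countable ∧ x ∈ closure B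

/-- the functional of a measure -/
def radFun (L : Type*) [TopologicalSpace L] (μ : RadonProb L) (g : C(L, ℝ)) : ℝ :=
  ∫ x, g x ∂μ.1

lemma exists_countable_lift {X Y : Type*} {f : X → Y} {A : Set X} {B : Set Y}
    (hB : B ⊆ f '' A) (hBc : B.Countable) : ∃ C ⊆ A, C.Countable ∧ f '' C = B := by
  choose g hg using fun b : B => hB b.2
  have := hBc.to_subtype
  refine ⟨range g, ?_, countable_range g, ?_⟩
  · rintro _ ⟨b, rfl⟩; exact (hg b).1
  · rw [← range_comp]
    ext y
    constructor
    · rintro ⟨b, rfl⟩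
      simp only [Function.comp, (hg b).2, b.2]
    · intro hy
      exact ⟨⟨y, hy⟩, (hg ⟨y, hy⟩).2⟩

lemma tight_of_inducing {X Y : Type*} [TopologicalSpace X] [TopologicalSpace Y] (f : X → Y)
    (hf : Topology.IsInducing f) : CountablyTight X ↔ TightSet (range f) := by
  constructor
  · rintro h A hA _ ⟨x, rfl⟩ hx
    have : x ∈ closure (f ⁻¹' A) := by
      rw [hf.closure_eq_preimage_closure_image, mem_preimage, image_preimage_eq_of_subset hA]
      exact hx
    obtain ⟨B, hB, hBc, hxB⟩ := h _ _ this
    exact ⟨f '' B, by simpa using hB, hBc.image f,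
      by rwa [hf.closure_eq_preimage_closure_image] at hxB⟩
  · intro h A x hx
    rw [hf.closure_eq_preimage_closure_image] at hx
    obtain ⟨B, hB, hBc, hxB⟩ := h (f '' A) (image_subset_range f A) (f x) ⟨x, rfl⟩ hx
    obtain ⟨C, hCA, hCc, rfl⟩ : ∃ C ⊆ A, C.Countable ∧ f '' C = B := by
      exact (exists_countable_lift hB hBc)
    exact ⟨C, hCA, hCc, by rwa [hf.closure_eq_preimage_closure_image]⟩

lemma range_radFun (L : Type*) [TopologicalSpace L] [CompactSpace L] [T2Space L] :
    range (radFun L) = St L := by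
  let _ : MeasurableSpace L := borel L
  have : BorelSpace L := ⟨rfl⟩
  ext φ
  constructor
  · rintro ⟨⟨μ, hμ, hμ'⟩, rfl⟩
    have hint : ∀ g : C(L, ℝ), Integrable (fun x => g x) μ := fun g =>
      (BoundedContinuousFunction.mkOfCompact g).integrable μ
    refine ⟨⟨?_, ?_, ?_⟩, ?_⟩
    · intro f g
      exact integral_add (hint f) (hint g)
    · intro c f
      exact integral_const_mul c _
    · intro f hf
      exact integral_nonneg fun x => hf x
    · simp [radFun]
  · rintro ⟨h, h1⟩
    let Λ : CompactlySupportedContinuousMap L ℝ →ₚ[ℝ] ℝ :=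
      PositiveLinearMap.mk₀
        { toFun := fun f => φ f.toContinuousMap
          map_add' := fun f g => h.add _ _
          map_smul' := fun c f => h.smul c _ }
        (fun f hf => h.nonneg _ hf)
    have key : ∀ g : C(L, ℝ), ∫ x, g x ∂(RealRMK.rieszMeasure Λ) = φ g := fun g =>
      RealRMK.integral_rieszMeasure Λ (CompactlySupportedContinuousMap.continuousMapEquiv g)
    have hp : IsProbabilityMeasure (RealRMK.rieszMeasure Λ) := by
      have := key 1
      rw [h1] at this
      simp only [ContinuousMap.one_apply, integral_const, smul_eq_mul, mul_one] at this
      constructor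
      rw [Measure.real, ENNReal.toReal_eq_one_iff] at this
      exact this
    exact ⟨⟨RealRMK.rieszMeasure Λ, hp, inferInstance⟩, funext key⟩

lemma tight_iff (L : Type*) [TopologicalSpace L] [CompactSpace L] [T2Space L] :
    CountablyTight (RadonProb L) ↔ TightSet (St L) := by
  rw [← range_radFun]
  exact tight_of_inducing _ ⟨rfl⟩

/-! ### Property (C) implies countable tightness -/

lemma star {L : Type*} [TopologicalSpace L] [CompactSpace L] (hC : PropertyC C(L, ℝ))
    {M : Set (C(L, ℝ) → ℝ)} {μ : C(L, ℝ) → ℝ} (hM : M ⊆ St L) (hμ : μ ∈ St L)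
    (h : μ ∈ closure M) : ∃ N ⊆ M, N.Countable ∧ ∀ x, ∃ ν ∈ N, ν x - μ x < 1 := by
  by_contra! hcon
  obtain ⟨x, hx⟩ := hC ((fun ν : C(L, ℝ) → ℝ => {x | 1 ≤ ν x - μ x}) '' M) (by
    rintro _ ⟨ν, hν, rfl⟩
    have hν := hM hν
    constructor
    · exact isClosed_le continuous_const (hν.1.continuous.sub hμ.1.continuous)
    · intro x hx y hy a b ha hb hab
      simp only [mem_ofPred_eq] at hx hy ⊢
      rw [hν.1.add, hμ.1.add, hν.1.smul, hν.1.smul, hμ.1.smul, hμ.1.smul]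
      have : (1 : ℝ) = a * 1 + b * 1 := by linarith
      rw [this]
      nlinarith [mul_le_mul_of_nonneg_left hx ha, mul_le_mul_of_nonneg_left hy hb]) (by
    intro D hD hDc
    obtain ⟨N, hNM, hNc, rfl⟩ := exists_countable_lift hD hDc
    obtain ⟨x, hx⟩ := hcon N hNM hNc
    refine ⟨x, ?_⟩
    rintro _ ⟨ν, hν, rfl⟩
    exact hx ν hν)
  obtain ⟨ν, hν, hlt⟩ := mem_closure_fun.1 h {x} 1 one_pos
  have h1 := hlt x (by simp)
  have h2 : 1 ≤ ν x - μ x := hx _ ⟨ν, hν, rfl⟩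
  rw [abs_lt] at h1
  linarith

section Inner

variable {K : Type*} [TopologicalSpace K] [CompactSpace K] {m : C(K, ℝ) → ℝ}

/-- partial integration in the second variable -/
def innerFn (hm : IsPos m) (p : C(K, ℝ)) (φ : C(K × K, ℝ)) : C(K, ℝ) :=
  ⟨fun x => m (p * φ.curry x), hm.continuous.comp (continuous_const.mul φ.curry.continuous)⟩

/-- the relatively independent joining given by a partition of unity -/
def lam (hm : IsPos m) {n : ℕ} (p : Fin n → C(K, ℝ)) (φ : C(K × K, ℝ)) : ℝ :=
  ∑ i, (m (p i))⁻¹ * m (p i * innerFn hm (p i) φ)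

/-- finite partition of unity -/
def IsPU {n : ℕ} (p : Fin n → C(K, ℝ)) : Prop := (∀ i, 0 ≤ p i) ∧ ∑ i, p i = 1

lemma lam_isPos (hm : IsPos m) {n : ℕ} {p : Fin n → C(K, ℝ)} (hp : IsPU p) : IsPos (lam hm p) := by
  refine ⟨?_, ?_, ?_⟩
  · intro f g
    simp only [lam]
    rw [← Finset.sum_add_distrib]
    refine Finset.sum_congr rfl fun i _ => ?_
    have : innerFn hm (p i) (f + g) = innerFn hm (p i) f + innerFn hm (p i) g := by
      ext x
      simp only [innerFn, ContinuousMap.coe_mk, ContinuousMap.add_apply]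
      rw [← hm.add]; congr 1; ext y; simp [mul_add]
    rw [this, mul_add, hm.add, mul_add]
  · intro c f
    simp only [lam]
    rw [Finset.mul_sum]
    refine Finset.sum_congr rfl fun i _ => ?_
    have : innerFn hm (p i) (c • f) = c • innerFn hm (p i) f := by
      ext x
      simp only [innerFn, ContinuousMap.coe_mk, ContinuousMap.smul_apply, smul_eq_mul]
      rw [← hm.smul]; congr 1; ext y; simp [mul_left_comm]
    rw [this, mul_smul_comm, hm.smul]; ring
  · intro f hf
    refine Finset.sum_nonneg fun i _ => mul_nonneg (inv_nonneg.2 (hm.nonneg _ (hp.1 i))) ?_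
    refine hm.nonneg _ fun x => mul_nonneg (hp.1 i x) ?_
    exact hm.nonneg _ fun y => mul_nonneg (hp.1 i y) (hf (x, y))

lemma zero_of_zero (hm : IsPos m) {p : C(K, ℝ)} (hp : 0 ≤ p) (h0 : m p = 0) (f : C(K, ℝ)) :
    m (p * f) = 0 := by
  have h1 := hm.abs_le (p * f)
  have h2 : m |p * f| ≤ m (‖f‖ • p) := hm.mono fun x => by
    have hpx : 0 ≤ p x := hp x
    have := f.norm_coe_le_norm x
    rw [Real.norm_eq_abs] at this
    simp only [ContinuousMap.abs_apply, ContinuousMap.mul_apply, abs_mul, abs_of_nonneg hpx,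
      ContinuousMap.smul_apply, smul_eq_mul]
    nlinarith
  rw [hm.smul, h0, mul_zero] at h2
  exact abs_nonpos_iff.1 (h1.trans h2)

lemma cancel (hm : IsPos m) {p : C(K, ℝ)} (hp : 0 ≤ p) (f : C(K, ℝ)) :
    (m p)⁻¹ * (m p * m (p * f)) = m (p * f) := by
  by_cases h : m p = 0
  · rw [zero_of_zero hm hp h]; simp
  · field_simp

/-- functions of the first variable only -/
lemma lam_fst (hm : IsPos m) {n : ℕ} {p : Fin n → C(K, ℝ)} (hp : IsPU p) (f : C(K, ℝ)) :
    lam hm p (f.comp ContinuousMap.fst) = m f := by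
  have : ∀ i, innerFn hm (p i) (f.comp ContinuousMap.fst) = m (p i) • f := by
    intro i; ext x
    simp only [innerFn, ContinuousMap.coe_mk, ContinuousMap.smul_apply, smul_eq_mul]
    rw [mul_comm (m (p i)), ← hm.smul]; congr 1; ext y; simp [mul_comm]
  simp only [lam, this, mul_smul_comm, hm.smul, cancel hm (hp.1 _)]
  rw [← hm.sum, ← Finset.sum_mul, hp.2, one_mul]

lemma lam_mem (hm : m ∈ St K) {n : ℕ} {p : Fin n → C(K, ℝ)} (hp : IsPU p) :
    lam hm.1 p ∈ St (K × K) := by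
  refine ⟨lam_isPos hm.1 hp, ?_⟩
  have := lam_fst hm.1 hp 1
  exact this.trans hm.2

/-- the test function `(f x - f y)^2` -/
def sqd (f : C(K, ℝ)) : C(K × K, ℝ) :=
  (f.comp ContinuousMap.fst - f.comp ContinuousMap.snd) ^ 2

lemma lam_sqd (hm : m ∈ St K) {n : ℕ} {p : Fin n → C(K, ℝ)} (hp : IsPU p) (f : C(K, ℝ)) :
    lam hm.1 p (sqd f) = 2 * (m (f ^ 2) - ∑ i, (m (p i))⁻¹ * m (p i * f) ^ 2) := by
  have hm1 := hm.1
  have : ∀ i, innerFn hm.1 (p i) (sqd f) =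
      m (p i) • f ^ 2 - (2 * m (p i * f)) • f + (m (p i * f ^ 2)) • 1 := by
    intro i; ext x
    simp only [innerFn, ContinuousMap.coe_mk, ContinuousMap.smul_apply, smul_eq_mul,
      ContinuousMap.add_apply, ContinuousMap.sub_apply, ContinuousMap.one_apply,
      ContinuousMap.pow_apply, mul_one]
    have : p i * (sqd f).curry x =
      (f x ^ 2) • p i - (2 * f x) • (p i * f) + p i * f ^ 2 := by
      ext y; simp [sqd]; ring
    rw [this, hm1.add, hm1.sub, hm1.smul, hm1.smul]; ring
  have h2 : ∀ i, (m (p i))⁻¹ * m (p i * innerFn hm.1 (p i) (sqd f)) =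
      2 * (m (p i * f ^ 2) - (m (p i))⁻¹ * m (p i * f) ^ 2) := by
    intro i
    rw [this, mul_add, mul_sub, mul_smul_comm, mul_smul_comm, mul_smul_comm, hm1.add, hm1.sub,
      hm1.smul, hm1.smul, hm1.smul, mul_one]
    linear_combination 2 * cancel hm1 (hp.1 i) (f ^ 2)
  simp only [lam, h2]
  rw [← Finset.mul_sum, Finset.sum_sub_distrib, ← hm1.sum, ← Finset.sum_mul, hp.2, one_mul]

lemma approx_of_lam (hm : m ∈ St K) {n : ℕ} {p : Fin n → C(K, ℝ)} (hp : IsPU p) (f : C(K, ℝ)) :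
    ∃ d : Fin n → ℝ, m ((f - ∑ i, d i • p i) ^ 2) ≤ lam hm.1 p (sqd f) / 2 := by
  have hm1 := hm.1
  refine ⟨fun i => (m (p i))⁻¹ * m (p i * f), ?_⟩
  rw [lam_sqd hm hp]
  set d : Fin n → ℝ := fun i => (m (p i))⁻¹ * m (p i * f) with hd
  set u := ∑ i, d i • p i with hu
  have h1 : (f - u) ^ 2 = f ^ 2 - (2 : ℝ) • (∑ i, d i • (p i * f)) + u ^ 2 := by
    have : ∑ i, d i • (p i * f) = u * f := by
      rw [hu, Finset.sum_mul]; exact Finset.sum_congr rfl fun i _ => by rw [smul_mul_assoc]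
    rw [this]; ext x; simp; ring
  have h2 : m (u ^ 2) ≤ ∑ i, (d i) ^ 2 * m (p i) := by
    have : ∑ i, (d i) ^ 2 * m (p i) = m (∑ i, (d i) ^ 2 • p i) := by
      rw [hm1.sum]; exact Finset.sum_congr rfl fun i _ => (hm1.smul _ _).symm
    rw [this]
    refine hm1.mono fun x => ?_
    simp only [hu, ContinuousMap.pow_apply, ContinuousMap.coe_sum, Finset.sum_apply,
      ContinuousMap.smul_apply, smul_eq_mul]
    have hs : ∑ i, p i x = 1 := by
      have := congrArg (fun g : C(K, ℝ) => g x) hp.2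
      simpa using this
    have := Finset.sum_sq_le_sum_mul_sum_of_sq_le_mul Finset.univ (r := fun i => d i * p i x)
      (f := fun i => p i x) (g := fun i => d i ^ 2 * p i x)
      (fun i _ => hp.1 i x) (fun i _ => mul_nonneg (sq_nonneg _) (hp.1 i x))
      (fun i _ => le_of_eq (by ring))
    rwa [hs, one_mul] at this
  have h3 : ∀ i, d i * m (p i * f) = (m (p i))⁻¹ * m (p i * f) ^ 2 := fun i => by
    simp only [hd]; ring
  have h4 : ∀ i, d i ^ 2 * m (p i) = (m (p i))⁻¹ * m (p i * f) ^ 2 := fun i => by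
    simp only [hd]
    linear_combination (m (p i))⁻¹ * m (p i * f) * cancel hm1 (hp.1 i) f
  rw [h1, hm1.add, hm1.sub, hm1.smul, hm1.sum]
  simp only [hm1.smul, h3]
  simp only [h4] at h2
  linarith

/-- the diagonal state -/
def diagSt (m : C(K, ℝ) → ℝ) (φ : C(K × K, ℝ)) : ℝ :=
  m (φ.comp ((ContinuousMap.id K).prodMk (ContinuousMap.id K)))

lemma diag_mem (hm : m ∈ St K) : diagSt m ∈ St (K × K) := by
  refine ⟨⟨fun f g => hm.1.add (f.comp _) (g.comp _),
    fun c f => hm.1.smul c (f.comp _), fun f hf => hm.1.nonneg _ ?_⟩, hm.2⟩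
  intro x; exact hf (x, x)

lemma diag_closure [T2Space K] (hm : m ∈ St K) :
    diagSt m ∈ closure {ν | ∃ n, ∃ p : Fin n → C(K, ℝ), IsPU p ∧ ν = lam hm.1 p} := by
  rw [mem_closure_fun]
  intro J ε hε
  have hm1 := hm.1
  have hU : ∀ x : K, ∃ U : Set K, IsOpen U ∧ x ∈ U ∧ ∀ φ ∈ J, ∀ y ∈ U, ∀ z ∈ U,
      |φ (y, z) - φ (y, y)| ≤ ε / 2 := by
    intro x
    have h1 : ∀ φ ∈ J, ∀ᶠ U in (nhds x).smallSets, ∀ y ∈ U, ∀ z ∈ U,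
        |φ (y, z) - φ (y, y)| ≤ ε / 2 := by
      intro φ _
      have hc : Filter.Tendsto φ (nhds (x, x)) (nhds (φ (x, x))) := φ.continuous.continuousAt
      have := hc (Metric.ball_mem_nhds _ (show 0 < ε / 4 by linarith))
      rw [nhds_prod_eq, Filter.mem_map, Filter.mem_prod_same_iff] at this
      obtain ⟨t, ht, hts⟩ := this
      rw [Filter.eventually_smallSets]
      refine ⟨t, ht, fun U hUt y hy z hz => ?_⟩
      have a1 := hts (mk_mem_prod (hUt hy) (hUt hz))
      have a2 := hts (mk_mem_prod (hUt hy) (hUt hy))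
      simp only [mem_preimage, Metric.mem_ball, Real.dist_eq, abs_lt] at a1 a2
      rw [abs_le]; constructor <;> linarith [a1.1, a1.2, a2.1, a2.2]
    have h2 := (Filter.eventually_all_finset J).2 h1
    rw [Filter.eventually_smallSets] at h2
    obtain ⟨s, hs, hs'⟩ := h2
    obtain ⟨U, hUs, hUo, hxU⟩ := mem_nhds_iff.1 hs
    exact ⟨U, hUo, hxU, fun φ hφ => hs' U hUs φ hφ⟩
  choose U hUo hxU hUφ using hU
  obtain ⟨t, ht⟩ := isCompact_univ.elim_finite_subcover U hUo (fun x _ => mem_iUnion.2 ⟨x, hxU x⟩)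
  have e := t.equivFin
  obtain ⟨p, hpU, hp1, hp01, -⟩ := exists_continuous_sum_one_of_isOpen_isCompact
    (s := fun i : Fin t.card => U (e.symm i)) (t := (univ : Set K))
    (fun i => hUo _) isCompact_univ (by
      intro x hx
      obtain ⟨y, hy, hxy⟩ := mem_iUnion₂.1 (ht hx)
      exact mem_iUnion.2 ⟨e ⟨y, hy⟩, by simpa using hxy⟩)
  have hp : IsPU p := ⟨fun i x => (hp01 i x).1, by ext x; simpa using hp1 (mem_univ x)⟩
  refine ⟨_, ⟨_, p, hp, rfl⟩, fun φ hφ => ?_⟩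
  set φ' : C(K × K, ℝ) :=
    (φ.comp ((ContinuousMap.id K).prodMk (ContinuousMap.id K))).comp ContinuousMap.fst with hφ'
  have h1 : diagSt m φ = lam hm1 p φ' := (lam_fst hm1 hp _).symm
  have hL := lam_isPos hm1 hp
  rw [h1, ← hL.sub]
  refine (hL.abs_le _).trans_lt ?_
  have h2 : lam hm1 p |φ - φ'| ≤ lam hm1 p ((ε / 2) • 1) := by
    refine Finset.sum_le_sum fun i _ =>
      mul_le_mul_of_nonneg_left ?_ (inv_nonneg.2 (hm1.nonneg _ (hp.1 i)))
    refine hm1.mono fun x => ?_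
    rw [ContinuousMap.mul_apply, ContinuousMap.mul_apply]
    by_cases hx : p i x = 0
    · rw [hx]; simp
    refine mul_le_mul_of_nonneg_left ?_ (hp.1 i x)
    refine hm1.mono fun y => ?_
    rw [ContinuousMap.mul_apply, ContinuousMap.mul_apply]
    by_cases hy : p i y = 0
    · rw [hy]; simp
    refine mul_le_mul_of_nonneg_left ?_ (hp.1 i y)
    have := hUφ _ φ hφ x (hpU i (subset_tsupport _ hx)) y (hpU i (subset_tsupport _ hy))
    simpa [hφ'] using this
  rw [hL.smul, (lam_mem hm hp).2] at h2
  linarith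

lemma cs (hm : m ∈ St K) (f : C(K, ℝ)) : (m |f|) ^ 2 ≤ m (f ^ 2) := by
  have h := hm.1.nonneg ((|f| - (m |f|) • 1) ^ 2) (fun x => sq_nonneg _)
  have : (|f| - (m |f|) • 1) ^ 2 = f ^ 2 - (2 * m |f|) • |f| + (m |f|) ^ 2 • (1 : C(K, ℝ)) := by
    ext x; simp only [ContinuousMap.pow_apply, ContinuousMap.sub_apply, ContinuousMap.abs_apply,
      ContinuousMap.smul_apply, ContinuousMap.add_apply, ContinuousMap.one_apply, smul_eq_mul]
    rw [sub_sq, sq_abs]; ring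
  rw [this, hm.1.add, hm.1.sub, hm.1.smul, hm.1.smul, hm.2] at h
  nlinarith

lemma tri {L : Type*} [TopologicalSpace L] [CompactSpace L] {m : C(L, ℝ) → ℝ}
    (hm : IsPos m) (f g h : C(L, ℝ)) :
    m |f - h| ≤ m |f - g| + m |g - h| := by
  rw [← hm.add]; exact hm.mono fun x => by simpa using abs_sub_le (f x) (g x) (h x)

/-- `G` is dense for the `L¹`-seminorm -/
def L1Dense {L : Type*} [TopologicalSpace L] (m : C(L, ℝ) → ℝ) (G : Set C(L, ℝ)) : Prop :=
  ∀ f : C(L, ℝ), ∀ ε > 0, ∃ g ∈ G, m |f - g| < ε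

lemma L1Dense.of_separable {L : Type*} [TopologicalSpace L] [CompactSpace L] {m : C(L, ℝ) → ℝ}
    (hm : m ∈ St L) {V : Set C(L, ℝ)} (hV : TopologicalSpace.IsSeparable V) (h : L1Dense m V) :
    ∃ G : Set C(L, ℝ), G.Countable ∧ L1Dense m G := by
  obtain ⟨G, hGc, hG⟩ := hV
  refine ⟨G, hGc, fun f ε hε => ?_⟩
  obtain ⟨u, hu, hfu⟩ := h f (ε / 2) (by linarith)
  obtain ⟨g, hg, hug⟩ := Metric.mem_closure_iff.1 (hG hu) (ε / 2) (by linarith)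
  refine ⟨g, hg, (tri hm.1 f u g).trans_lt ?_⟩
  have : m |u - g| ≤ ‖u - g‖ * m 1 :=
    hm.1.le_of_le_const fun x => by simpa using (u - g).norm_coe_le_norm x
  rw [hm.2, ← dist_eq_norm] at this
  linarith

lemma countable_type [T2Space K] (hC : PropertyC C(K × K, ℝ)) (hm : m ∈ St K) :
    ∃ G : Set C(K, ℝ), G.Countable ∧ L1Dense m G := by
  obtain ⟨N, hN, hNc, hstar⟩ := star hC (by rintro ν ⟨n, p, hp, rfl⟩; exact lam_mem hm hp)
    (diag_mem hm) (diag_closure hm)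
  choose n p hp hpν using fun ν : N => hN ν.2
  have := hNc.to_subtype
  let V := Submodule.span ℝ (⋃ ν : N, range (p ν))
  have hV : TopologicalSpace.IsSeparable (V : Set C(K, ℝ)) :=
    (Set.Countable.isSeparable (countable_iUnion fun ν => countable_range _)).span
  refine L1Dense.of_separable hm hV fun f ε hε => ?_
  obtain ⟨ν, hν, hlt⟩ := hstar ((ε ^ 2)⁻¹ • sqd f)
  rw [(hM_pos hN hm hν).smul, (diag_mem hm).1.smul] at hlt
  have h0 : diagSt m (sqd f) = 0 := by
    have : (sqd f).comp ((ContinuousMap.id K).prodMk (ContinuousMap.id K)) = 0 := by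
      ext x; simp [sqd]
    rw [diagSt, this, hm.1.zero]
  rw [h0, mul_zero, sub_zero, inv_mul_lt_iff₀ (by positivity), mul_one] at hlt
  obtain ⟨d, hd⟩ := approx_of_lam hm (hp ⟨ν, hν⟩) f
  rw [← hpν ⟨ν, hν⟩] at hd
  refine ⟨∑ i, d i • p ⟨ν, hν⟩ i, ?_, ?_⟩
  · exact Submodule.sum_mem _ fun i _ => Submodule.smul_mem _ _
      (Submodule.subset_span (mem_iUnion.2 ⟨⟨ν, hν⟩, i, rfl⟩))
  · have h1 := cs hm (f - ∑ i, d i • p ⟨ν, hν⟩ i)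
    refine lt_of_pow_lt_pow_left₀ 2 hε.le ?_
    have : 0 < ε ^ 2 := by positivity
    simp only at hd
    linarith
where
  hM_pos {N : Set (C(K × K, ℝ) → ℝ)}
      (hN : N ⊆ {ν | ∃ n, ∃ p : Fin n → C(K, ℝ), IsPU p ∧ ν = lam hm.1 p})
      (hm : m ∈ St K) {ν} (hν : ν ∈ N) : IsPos ν := by
    obtain ⟨n, p, hp, rfl⟩ := hN hν
    exact lam_isPos hm.1 hp

end Inner

lemma countable_type_prod {K : Type*} [TopologicalSpace K] [CompactSpace K] [T2Space K]
    (hC : PropertyC C(K × K, ℝ)) {s : C(K × K, ℝ) → ℝ} (hs : s ∈ St (K × K)) :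
    ∃ G : Set C(K × K, ℝ), G.Countable ∧ L1Dense s G := by
  have hm : ∀ q : C(K × K, K), (fun f : C(K, ℝ) => s (f.comp q)) ∈ St K := fun q =>
    ⟨⟨fun f g => hs.1.add (f.comp q) (g.comp q), fun c f => hs.1.smul c (f.comp q),
      fun f hf => hs.1.nonneg _ fun x => hf (q x)⟩, hs.2⟩
  obtain ⟨G1, hG1c, hG1⟩ := countable_type hC (hm ContinuousMap.fst)
  obtain ⟨G2, hG2c, hG2⟩ := countable_type hC (hm ContinuousMap.snd)
  let E : Set C(K × K, ℝ) := (fun f : C(K, ℝ) => f.comp ContinuousMap.fst) '' G1 ∪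
    (fun f : C(K, ℝ) => f.comp ContinuousMap.snd) '' G2
  have hE : E.Countable := (hG1c.image _).union (hG2c.image _)
  let V : Subalgebra ℝ C(K × K, ℝ) := Algebra.adjoin ℝ E
  have hV : TopologicalSpace.IsSeparable (V : Set C(K × K, ℝ)) := by
    have h1 : (Submonoid.closure E : Set C(K × K, ℝ)).Countable := by
      rw [Submonoid.closure_eq_mrange, MonoidHom.coe_mrange]
      have := hE.to_subtype
      have : Countable (FreeMonoid E) := inferInstanceAs (Countable (List E))
      exact countable_range _
    have h2 := (h1.isSeparable).span (R := ℝ)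
    rw [← Algebra.adjoin_eq_span] at h2
    exact h2
  have habs : ∀ (F u : C(K × K, ℝ)) (H : C(K × K, ℝ)),
      s |F * H - u * H| ≤ ‖H‖ * s |F - u| := by
    intro F u H
    rw [← hs.1.smul]
    refine hs.1.mono fun x => ?_
    have := H.norm_coe_le_norm x
    rw [Real.norm_eq_abs] at this
    simp only [ContinuousMap.abs_apply, ContinuousMap.sub_apply, ContinuousMap.mul_apply,
      ContinuousMap.smul_apply, smul_eq_mul]
    rw [← sub_mul, abs_mul, mul_comm]
    exact mul_le_mul_of_nonneg_right this (abs_nonneg _)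
  let T : Subalgebra ℝ C(K × K, ℝ) :=
    { carrier := {F | ∀ ε > 0, ∃ u ∈ V, s |F - u| < ε}
      mul_mem' := by
        intro F H hF hH ε hε
        obtain ⟨u, hu, hFu⟩ := hF (ε / 2 / (‖H‖ + 1)) (by positivity)
        obtain ⟨v, hv, hHv⟩ := hH (ε / 2 / (‖u‖ + 1)) (by positivity)
        refine ⟨u * v, V.mul_mem hu hv, (tri hs.1 _ (u * H) _).trans_lt ?_⟩
        have h1 := habs F u H
        have h2 := habs H v u
        rw [mul_comm H u, mul_comm v u] at h2
        rw [lt_div_iff₀ (by positivity)] at hFu hHv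
        have h3 : 0 ≤ s |F - u| := hs.1.nonneg _ (abs_nonneg _)
        have h4 : 0 ≤ s |H - v| := hs.1.nonneg _ (abs_nonneg _)
        nlinarith
      add_mem' := by
        intro F H hF hH ε hε
        obtain ⟨u, hu, hFu⟩ := hF (ε / 2) (by positivity)
        obtain ⟨v, hv, hHv⟩ := hH (ε / 2) (by positivity)
        refine ⟨u + v, V.add_mem hu hv, (tri hs.1 _ (u + H) _).trans_lt ?_⟩
        rw [add_sub_add_right_eq_sub, add_sub_add_left_eq_sub]
        linarith
      algebraMap_mem' := by
        intro r ε hε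
        refine ⟨_, V.algebraMap_mem r, ?_⟩
        simp [hs.1.zero, hε] }
  have hT1 : ∀ f : C(K, ℝ), f.comp ContinuousMap.fst ∈ T := by
    intro f ε hε
    obtain ⟨g, hg, hfg⟩ := hG1 f ε hε
    exact ⟨g.comp ContinuousMap.fst, Algebra.subset_adjoin (Or.inl ⟨g, hg, rfl⟩), hfg⟩
  have hT2 : ∀ f : C(K, ℝ), f.comp ContinuousMap.snd ∈ T := by
    intro f ε hε
    obtain ⟨g, hg, hfg⟩ := hG2 f ε hε
    exact ⟨g.comp ContinuousMap.snd, Algebra.subset_adjoin (Or.inr ⟨g, hg, rfl⟩), hfg⟩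
  have hsep : T.SeparatesPoints := by
    rintro ⟨x, y⟩ ⟨x', y'⟩ hne
    by_cases hx : x = x'
    · have hy : y ≠ y' := fun h => hne (by rw [hx, h])
      obtain ⟨f, hf, hff⟩ := separatesPoints_continuous_of_t35Space hy
      exact ⟨_, ⟨_, hT2 ⟨f, hf⟩, rfl⟩, hff⟩
    · obtain ⟨f, hf, hff⟩ := separatesPoints_continuous_of_t35Space hx
      exact ⟨_, ⟨_, hT1 ⟨f, hf⟩, rfl⟩, hff⟩
  have htop := ContinuousMap.subalgebra_topologicalClosure_eq_top_of_separatesPoints T hsep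
  refine L1Dense.of_separable hs hV fun F ε hε => ?_
  have hF : F ∈ T.topologicalClosure := by rw [htop]; trivial
  obtain ⟨H, hH, hFH⟩ := Metric.mem_closure_iff.1 hF (ε / 2) (by linarith)
  obtain ⟨u, hu, hHu⟩ := hH (ε / 2) (by linarith)
  refine ⟨u, hu, (tri hs.1 F H u).trans_lt ?_⟩
  have : s |F - H| ≤ ‖F - H‖ * s 1 :=
    hs.1.le_of_le_const fun x => by simpa using (F - H).norm_coe_le_norm x
  rw [hs.2, ← dist_eq_norm] at this
  linarith

lemma cluster_mem {X : Type*} [TopologicalSpace X] {l : X} {ν : ℕ → X}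
    (h : MapClusterPt l Filter.atTop ν) {C : Set X} (hC : ∀ᶠ n in Filter.atTop, ν n ∈ C) :
    l ∈ closure C :=
  mem_closure_iff_clusterPt.2 (ClusterPt.mono h (Filter.le_principal_iff.2 hC))

lemma tight_of_C {L : Type*} [TopologicalSpace L] [CompactSpace L]
    (hC : PropertyC C(L, ℝ))
    (hct : ∀ s ∈ St L, ∃ G : Set C(L, ℝ), G.Countable ∧ L1Dense s G) : TightSet (St L) := by
  classical
  intro A hA μ hμ hcl
  obtain ⟨G, hGc, hG⟩ := hct μ hμ
  obtain ⟨g, rfl⟩ := hGc.exists_eq_range (by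
    obtain ⟨g, hg, -⟩ := hG 0 1 one_pos
    exact ⟨g, hg⟩)
  let M : Set (C(L, ℝ) → ℝ) := {l | l ∈ St L ∧ (∀ n, l (g n) = μ (g n)) ∧
    ∃ B ⊆ A, B.Countable ∧ l ∈ closure B}
  have hM : μ ∈ closure M := by
    rw [mem_closure_fun]
    intro J ε hε
    have h1 : ∀ n : ℕ, ∃ ν ∈ A, ∀ j ∈ J ∪ (Finset.range n).image g,
        |ν j - μ j| < min (ε / 2) (1 / ((n : ℝ) + 1)) := fun n =>
      mem_closure_fun.1 hcl _ _ (lt_min (by linarith) (by positivity))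
    choose ν hνA hν using h1
    obtain ⟨l, hl, hlc⟩ := (isCompact_St L).exists_clusterPt (f := Filter.map ν Filter.atTop)
      (Filter.le_principal_iff.2 (Filter.mem_map.2 (Filter.univ_mem' fun n => hA (hνA n))))
    have hlc : MapClusterPt l Filter.atTop ν := hlc
    refine ⟨l, ⟨hl, ?_, range ν, ?_, countable_range ν, ?_⟩, ?_⟩
    · intro k
      have h2 : ∀ δ > 0, |l (g k) - μ (g k)| ≤ δ := by
        intro δ hδ
        have hcl : IsClosed {l : C(L, ℝ) → ℝ | |l (g k) - μ (g k)| ≤ δ} :=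
          isClosed_le (by fun_prop) continuous_const
        refine hcl.closure_subset (cluster_mem hlc ?_)
        obtain ⟨n0, hn0⟩ := exists_nat_one_div_lt hδ
        filter_upwards [Filter.eventually_ge_atTop (max n0 (k + 1))] with n hn
        have hn1 : n0 ≤ n := (le_max_left _ _).trans hn
        have hn2 : k + 1 ≤ n := (le_max_right _ _).trans hn
        have h3 := hν n (g k) (Finset.mem_union_right _
          (Finset.mem_image_of_mem g (Finset.mem_range.2 hn2)))
        have h4 : 1 / ((n : ℝ) + 1) ≤ 1 / ((n0 : ℝ) + 1) := by gcongr
        exact (h3.trans_le ((min_le_right _ _).trans h4)).le.trans hn0.le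
      have := le_of_forall_pos_le_add (fun δ hδ => by simpa using h2 δ hδ :
        ∀ δ > 0, |l (g k) - μ (g k)| ≤ 0 + δ)
      exact sub_eq_zero.1 (abs_nonpos_iff.1 this)
    · rintro _ ⟨n, rfl⟩; exact hνA n
    · exact cluster_mem hlc (Filter.Eventually.of_forall fun n => mem_range_self n)
    · intro j hj
      have hcl : IsClosed {l : C(L, ℝ) → ℝ | |l j - μ j| ≤ ε / 2} :=
        isClosed_le (by fun_prop) continuous_const
      have : |l j - μ j| ≤ ε / 2 := hcl.closure_subset (cluster_mem hlc
        (Filter.Eventually.of_forall fun n =>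
          ((hν n j (Finset.mem_union_left _ hj)).trans_le (min_le_left _ _)).le))
      linarith
  obtain ⟨N, hNM, hNc, hN⟩ := star hC (fun l hl => hl.1) hμ hM
  have hμN : μ ∈ closure N := by
    by_contra hcon
    rw [mem_closure_fun] at hcon
    push Not at hcon
    obtain ⟨J, ε, hε, hJ⟩ := hcon
    set η : ℝ := ε / (2 * (J.card + 1)) with hη
    have hη0 : 0 < η := by positivity
    have h1 : ∀ j : C(L, ℝ), ∃ k, μ |j - g k| < η := fun j => by
      obtain ⟨_, ⟨k, rfl⟩, hk⟩ := hG j η hη0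
      exact ⟨k, hk⟩
    choose k hk using h1
    set x : C(L, ℝ) := ∑ j ∈ J, |j - g (k j)| with hx
    have hμx : μ x ≤ J.card * η := by
      rw [hx, hμ.1.sum]
      calc _ ≤ ∑ j ∈ J, η := Finset.sum_le_sum fun j _ => (hk j).le
        _ = _ := by simp
    have hηε : (J.card + 1) * η = ε / 2 := by rw [hη]; field_simp
    obtain ⟨ν, hν, hlt⟩ := hN ((2 / ε) • x)
    have hνM := hNM hν
    rw [hνM.1.1.smul, hμ.1.smul, ← mul_sub, div_mul_eq_mul_div, div_lt_one hε] at hlt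
    obtain ⟨j, hj, hjε⟩ := hJ ν hν
    have h2 : ν |j - g (k j)| ≤ ν x := by
      refine hνM.1.1.mono fun y => ?_
      rw [hx, ContinuousMap.coe_sum, Finset.sum_apply]
      exact Finset.single_le_sum (f := fun i : C(L, ℝ) => |i - g (k i)| y)
        (fun i _ => abs_nonneg _) hj
    have h3 := hνM.1.1.abs_le (j - g (k j))
    have h4 := hμ.1.abs_le (j - g (k j))
    rw [hνM.1.1.sub, hνM.2.1] at h3
    rw [hμ.1.sub] at h4
    have h5 := hk j
    have h6 : |ν j - μ j| ≤ |ν j - μ (g (k j))| + |μ j - μ (g (k j))| := by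
      have := abs_sub_le (ν j) (μ (g (k j))) (μ j)
      rwa [abs_sub_comm (μ (g (k j)))] at this
    nlinarith
  choose B hBA hBc hB using fun ν : N => (hNM ν.2).2.2
  have := hNc.to_subtype
  refine ⟨⋃ ν, B ν, iUnion_subset hBA, countable_iUnion hBc, ?_⟩
  refine closure_minimal ?_ isClosed_closure hμN
  intro ν hν
  exact closure_mono (subset_iUnion B ⟨ν, hν⟩) (hB ⟨ν, hν⟩)

/-! ### Countable tightness implies property (C) -/

lemma closed_of_omega {X : Type*} [TopologicalSpace X] (hX : CountablyTight X) {A : Set X}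
    (hA : ∀ B ⊆ A, B.Countable → closure B ⊆ A) : IsClosed A := by
  refine isClosed_of_closure_subset fun x hx => ?_
  obtain ⟨B, hB, hBc, hxB⟩ := hX A x hx
  exact hA B hB hBc hxB

lemma tight_of_omega {X : Type*} [TopologicalSpace X]
    (h : ∀ A : Set X, (∀ B ⊆ A, B.Countable → closure B ⊆ A) → IsClosed A) :
    CountablyTight X := by
  intro A x hx
  let W : Set X := {y | ∃ B ⊆ A, B.Countable ∧ y ∈ closure B}
  have hW : IsClosed W := by
    refine h W fun B hB hBc y hy => ?_
    choose D hDA hDc hD using fun b : B => hB b.2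
    have := hBc.to_subtype
    refine ⟨⋃ b, D b, iUnion_subset hDA, countable_iUnion hDc, ?_⟩
    refine closure_minimal ?_ isClosed_closure hy
    intro ν hν
    exact closure_mono (subset_iUnion D ⟨ν, hν⟩) (hD ⟨ν, hν⟩)
  have hAW : A ⊆ W := fun a ha => ⟨{a}, by simpa using ha, countable_singleton a,
    subset_closure rfl⟩
  exact closure_minimal hAW hW hx

lemma tight_prod {X Y : Type*} [TopologicalSpace X] [TopologicalSpace Y] [CompactSpace X]
    [CompactSpace Y] [T2Space X] [T2Space Y] (hX : CountablyTight X) (hY : CountablyTight Y) :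
    CountablyTight (X × Y) := by
  refine tight_of_omega fun A hA => isClosed_of_closure_subset ?_
  rintro ⟨x, y⟩ hz
  by_contra hzA
  have hfib : IsClosed ((fun t : X => (t, y)) ⁻¹' A) := by
    refine closed_of_omega hX fun B hB hBc t ht => ?_
    refine hA ((fun t : X => (t, y)) '' B) (image_subset_iff.2 hB) (hBc.image _) ?_
    exact image_closure_subset_closure_image (by fun_prop) ⟨t, ht, rfl⟩
  have hnb : ((fun t : X => (t, y)) ⁻¹' A)ᶜ ∈ nhds x := hfib.isOpen_compl.mem_nhds hzA
  obtain ⟨C, hC, hCc, hCs⟩ := exists_mem_nhds_isClosed_subset hnb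
  let A' : Set (X × Y) := A ∩ Prod.fst ⁻¹' C
  have hA'c : (x, y) ∈ closure A' := by
    rw [mem_closure_iff_nhds] at hz ⊢
    intro t ht
    have : t ∩ Prod.fst ⁻¹' C ∈ nhds (x, y) :=
      Filter.inter_mem ht (continuous_fst.continuousAt hC)
    obtain ⟨w, ⟨hw1, hw2⟩, hw3⟩ := hz _ this
    exact ⟨w, hw1, hw3, hw2⟩
  have himg : IsClosed (Prod.snd '' A') := by
    refine closed_of_omega hY fun B hB hBc => ?_
    obtain ⟨D, hDA, hDc, rfl⟩ := exists_countable_lift hB hBc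
    have h1 : closure D ⊆ A' := subset_inter
      (hA D (hDA.trans inter_subset_left) hDc)
      (closure_minimal (hDA.trans inter_subset_right) (hCc.preimage continuous_fst))
    have h2 : IsClosed (Prod.snd '' closure D) :=
      (isClosed_closure.isCompact.image continuous_snd).isClosed
    exact (closure_minimal (image_mono subset_closure) h2).trans (image_mono h1)
  have hy : y ∈ Prod.snd '' A' :=
    himg.closure_subset (image_closure_subset_closure_image continuous_snd ⟨_, hA'c, rfl⟩)
  obtain ⟨⟨t, y'⟩, ⟨ht1, ht2⟩, rfl⟩ := hy
  exact hCs ht2 ht1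

lemma tight_image {Z Y : Type*} [TopologicalSpace Z] [TopologicalSpace Y] [CompactSpace Z]
    [T2Space Y] (hZ : CountablyTight Z) {f : Z → Y} (hf : Continuous f) : TightSet (range f) := by
  intro A hA y _ hyA
  have h1 : IsClosed (f '' closure (f ⁻¹' A)) := (isClosed_closure.isCompact.image hf).isClosed
  have h2 : A ⊆ f '' closure (f ⁻¹' A) := by
    intro a ha
    obtain ⟨z, rfl⟩ := hA ha
    exact ⟨z, subset_closure ha, rfl⟩
  obtain ⟨z, hz, rfl⟩ := closure_minimal h2 h1 hyA
  obtain ⟨B, hB, hBc, hzB⟩ := hZ _ _ hz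
  exact ⟨f '' B, image_subset_iff.2 hB, hBc.image f, image_closure_subset_closure_image hf
    ⟨z, hzB, rfl⟩⟩

lemma tight_sub {Y : Type*} [TopologicalSpace Y] {S : Set Y} : TightSet S ↔ CountablyTight S := by
  rw [tight_of_inducing _ (Topology.IsInducing.subtypeVal : Topology.IsInducing
    (Subtype.val : S → Y)), Subtype.range_coe]

lemma tight_Icc (a b : ℝ) : CountablyTight (Icc a b) := by
  intro A x hx
  obtain ⟨u, hu, hux⟩ := mem_closure_iff_seq_limit.1 hx
  refine ⟨range u, by rintro _ ⟨n, rfl⟩; exact hu n, countable_range u, ?_⟩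
  exact mem_closure_of_tendsto hux (Filter.Eventually.of_forall fun n => mem_range_self n)

lemma dual_pi {ι : Type*} (l : StrongDual ℝ (ι → ℝ)) :
    ∃ (J : Finset ι) (c : ι → ℝ), ∀ v, l v = ∑ j ∈ J, c j * v j := by
  classical
  have h0 : l ⁻¹' Metric.ball 0 1 ∈ nhds (0 : ι → ℝ) :=
    l.continuous.continuousAt (by rw [map_zero]; exact Metric.ball_mem_nhds _ one_pos)
  rw [nhds_pi, Filter.mem_pi'] at h0
  obtain ⟨J, V, hV, hVt⟩ := h0
  have hz : ∀ v : ι → ℝ, (∀ j ∈ J, v j = 0) → l v = 0 := by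
    intro v hv
    by_contra hne
    have h1 : (l v)⁻¹ • v ∈ l ⁻¹' Metric.ball 0 1 := by
      refine hVt fun j hj => ?_
      have : ((l v)⁻¹ • v) j = (0 : ι → ℝ) j := by simp [hv j hj]
      rw [this]; exact mem_of_mem_nhds (hV j)
    simp [hne] at h1
  refine ⟨J, fun j => l (Pi.single j 1), fun v => ?_⟩
  have h1 := hz (v - ∑ j ∈ J, v j • Pi.single j (1 : ℝ)) (by
    intro j hj
    simp [Finset.sum_apply, Pi.single_apply, hj])
  rw [map_sub, map_sum, sub_eq_zero] at h1
  rw [h1]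
  exact Finset.sum_congr rfl fun j _ => by rw [map_smul, smul_eq_mul, mul_comm]

lemma isPos_combo {L : Type*} [TopologicalSpace L] {p q : C(L, ℝ) → ℝ} (hp : IsPos p)
    (hq : IsPos q) {a b : ℝ} (ha : 0 ≤ a) (hb : 0 ≤ b) : IsPos (a • p + b • q) := by
  refine ⟨fun f g => ?_, fun c f => ?_, fun f hf => ?_⟩
  · simp [hp.add, hq.add]; ring
  · simp [hp.smul, hq.smul]; ring
  · exact add_nonneg (mul_nonneg ha (hp.nonneg f hf)) (mul_nonneg hb (hq.nonneg f hf))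

lemma convex_P1 (L : Type*) [TopologicalSpace L] : Convex ℝ (P1 L) := by
  intro p hp q hq a b ha hb hab
  refine ⟨isPos_combo hp.1 hq.1 ha hb, ?_⟩
  have h1 := mul_le_mul_of_nonneg_left hp.2 ha
  have h2 := mul_le_mul_of_nonneg_left hq.2 hb
  simp only [Pi.add_apply, Pi.smul_apply, smul_eq_mul]
  linarith

/-- Every functional in the dual unit ball is a difference of positive functionals. -/
lemma ball_rep {L : Type*} [TopologicalSpace L] [CompactSpace L] [Nonempty L]
    (f : StrongDual ℝ C(L, ℝ)) (hf : ‖f‖ ≤ 1) : ∃ p ∈ P1 L, ∃ q ∈ P1 L, ∀ x, f x = p x - q x := by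
  let Q : Set (C(L, ℝ) → ℝ) := (fun z : (C(L, ℝ) → ℝ) × (C(L, ℝ) → ℝ) => z.1 - z.2) ''
    (P1 L ×ˢ P1 L)
  have hQc : IsCompact Q := ((isCompact_P1 L).prod (isCompact_P1 L)).image (by fun_prop)
  have hQconv : Convex ℝ Q := by
    have := (convex_P1 L).sub (convex_P1 L)
    rwa [← Set.sub_image_prod] at this
  by_cases hfQ : (fun x => f x) ∈ Q
  · obtain ⟨⟨p, q⟩, ⟨hp, hq⟩, h⟩ := hfQ
    exact ⟨p, hp, q, hq, fun x => (congrFun h x).symm⟩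
  exfalso
  obtain ⟨l, u, hl1, hl2⟩ := geometric_hahn_banach_closed_point hQconv hQc.isClosed hfQ
  obtain ⟨J, c, hc⟩ := dual_pi l
  set y : C(L, ℝ) := ∑ j ∈ J, c j • j with hy
  have h1 : l (fun x => f x) = f y := by
    rw [hc, hy, map_sum]; simp
  have hz : (0 : C(L, ℝ) → ℝ) ∈ P1 L :=
    ⟨⟨by simp, by simp, by simp⟩, by simp⟩
  have hδ : ∀ t : L, (fun x : C(L, ℝ) => x t) ∈ P1 L := fun t =>
    ⟨⟨by simp, by simp, fun f hf => hf t⟩, by simp⟩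
  have hyt : ∀ t, y t = ∑ j ∈ J, c j * j t := fun t => by
    simp [hy, ContinuousMap.coe_sum]
  have h2 : ∀ t, y t < u := fun t => by
    have := hl1 _ ⟨(_, _), ⟨hδ t, hz⟩, rfl⟩
    rw [hc] at this
    rw [hyt]; simpa using this
  have h3 : ∀ t, - y t < u := fun t => by
    have := hl1 _ ⟨(_, _), ⟨hz, hδ t⟩, rfl⟩
    rw [hc] at this
    rw [hyt]; simpa using this
  have h4 : ‖y‖ ≤ u := by
    rw [ContinuousMap.norm_le_of_nonempty]
    intro t
    rw [Real.norm_eq_abs]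
    exact abs_le'.2 ⟨(h2 t).le, (h3 t).le⟩
  have h5 : f y ≤ ‖y‖ := by
    have := (le_abs_self _).trans (f.le_opNorm y)
    nlinarith [norm_nonneg y]
  rw [h1] at hl2
  linarith

lemma tight_P1 {L : Type*} [TopologicalSpace L] [CompactSpace L] [Nonempty L]
    (h : TightSet (St L)) : CountablyTight (P1 L) := by
  have : CompactSpace (St L) := isCompact_iff_compactSpace.1 (isCompact_St L)
  have h1 := tight_prod (tight_sub.1 h) (tight_Icc 0 1)
  have h2 := tight_image h1 (f := fun z : St L × Icc (0 : ℝ) 1 => z.2.1 • z.1.1) (by fun_prop)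
  rw [← tight_sub]
  have h3 : P1 L ⊆ range (fun z : St L × Icc (0 : ℝ) 1 => z.2.1 • z.1.1) := by
    intro p hp
    by_cases h0 : p 1 = 0
    · obtain ⟨t⟩ := ‹Nonempty L›
      refine ⟨⟨⟨fun x => x t, ⟨by simp, by simp, fun f hf => hf t⟩, by simp⟩, ⟨0, by simp⟩⟩, ?_⟩
      ext x
      have := hp.1.abs_le_norm x
      rw [h0, mul_zero] at this
      simp [abs_nonpos_iff.1 this]
    · have hpos : 0 < p 1 := lt_of_le_of_ne hp.1.one_nonneg (Ne.symm h0)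
      refine ⟨⟨⟨(p 1)⁻¹ • p, ?_, by simp [h0]⟩, ⟨p 1, hpos.le, hp.2⟩⟩, ?_⟩
      · simpa using isPos_combo hp.1 hp.1 (inv_nonneg.2 hpos.le) le_rfl
      · simp [smul_smul, h0]
  intro A hA x hx hxA
  exact h2 A (hA.trans h3) x (h3 hx) hxA

lemma claim1 {L : Type*} [TopologicalSpace L] [CompactSpace L] [Nonempty L]
    (h : CountablyTight (P1 L)) (𝒞 : Set (Set C(L, ℝ))) (hcc : ∀ C ∈ 𝒞, Convex ℝ C)
    (hcip : ∀ 𝒟 ⊆ 𝒞, 𝒟.Countable → (⋂₀ 𝒟).Nonempty) (ε : ℝ) (hε : 0 < ε) :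
    ∃ x, ∀ C ∈ 𝒞, ∃ y ∈ C, dist y x < ε := by
  by_contra! hcon
  obtain ⟨R, hR⟩ : ∃ R : ℕ, ∀ 𝒟 ⊆ 𝒞, 𝒟.Countable → ∃ x ∈ ⋂₀ 𝒟, ‖x‖ ≤ R := by
    by_contra! hno
    choose D hD hDc hDx using hno
    obtain ⟨x, hx⟩ := hcip (⋃ n, D n) (iUnion_subset hD) (countable_iUnion hDc)
    obtain ⟨n, hn⟩ := exists_nat_ge ‖x‖
    exact absurd hn (not_le.2 (hDx n x fun C hC => hx C (mem_iUnion.2 ⟨n, hC⟩)))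
  have hcomp : CompactSpace (P1 L) := isCompact_iff_compactSpace.1 (isCompact_P1 L)
  let Φ : P1 L × P1 L × Icc (-(R : ℝ)) R → (C(L, ℝ) → ℝ) :=
    fun z x => z.1.1 x - z.2.1.1 x - z.2.2.1
  have hΦ : Continuous Φ := by
    refine continuous_pi fun x => ?_
    have h1 : Continuous fun z : P1 L × P1 L × Icc (-(R : ℝ)) R => z.1.1 x :=
      (continuous_apply x).comp (continuous_subtype_val.comp continuous_fst)
    have h2 : Continuous fun z : P1 L × P1 L × Icc (-(R : ℝ)) R => z.2.1.1 x :=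
      (continuous_apply x).comp (continuous_subtype_val.comp
        (continuous_fst.comp continuous_snd))
    exact (h1.sub h2).sub (continuous_subtype_val.comp (continuous_snd.comp continuous_snd))
  have hWt : TightSet (range Φ) := tight_image (tight_prod h (tight_prod h (tight_Icc _ _))) hΦ
  have hWc : IsCompact (range Φ) := isCompact_range hΦ
  let 𝒜 : Set (C(L, ℝ) → ℝ) := {F | F ∈ range Φ ∧ ∃ 𝒟 ⊆ 𝒞, 𝒟.Countable ∧
    ∀ x ∈ ⋂₀ 𝒟, ‖x‖ ≤ R → 0 ≤ F x}
  have h𝒜W : 𝒜 ⊆ range Φ := fun F hF => hF.1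
  have h𝒜conv : Convex ℝ 𝒜 := by
    rintro _ ⟨⟨⟨p, q, a⟩, rfl⟩, D, hD, hDc, hDx⟩ _ ⟨⟨⟨p', q', a'⟩, rfl⟩, D', hD', hDc', hDx'⟩
      s t hs ht hst
    refine ⟨⟨⟨⟨_, convex_P1 L p.2 p'.2 hs ht hst⟩, ⟨_, convex_P1 L q.2 q'.2 hs ht hst⟩,
      ⟨_, convex_Icc _ _ a.2 a'.2 hs ht hst⟩⟩, ?_⟩, D ∪ D', union_subset hD hD',
      hDc.union hDc', ?_⟩
    · ext x
      simp only [Φ, Pi.add_apply, Pi.smul_apply, smul_eq_mul]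
      ring
    · intro x hx hxR
      exact add_nonneg (mul_nonneg hs (hDx x (fun C hC => hx C (Or.inl hC)) hxR))
        (mul_nonneg ht (hDx' x (fun C hC => hx C (Or.inr hC)) hxR))
  set δ : ℝ := ε / 2 with hδ
  have hδ0 : 0 < δ := by positivity
  have hsep : ∀ x, ∃ z, Φ z ∈ 𝒜 ∧ Φ z x ≤ -δ := by
    intro x
    obtain ⟨C, hC, hCx⟩ := hcon x
    obtain ⟨f, u, hf1, hf2⟩ := geometric_hahn_banach_open (convex_ball x ε) Metric.isOpen_ball
      (hcc C hC) (by
        rw [disjoint_left]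
        intro y hy hyC
        exact absurd hy (not_lt.2 (hCx y hyC)))
    obtain ⟨y, hyC, hyR⟩ := hR {C} (by simpa using hC) (countable_singleton C)
    have hyC : y ∈ C := hyC C rfl
    have hnorm : ‖f‖ ≤ (u - f x) / δ := by
      refine f.opNorm_le_of_unit_norm ?_ ?_
      · have := hf1 x (Metric.mem_ball_self hε)
        exact div_nonneg (by linarith) hδ0.le
      · intro v hv
        have hb : ∀ s : ℝ, |s| = δ → f x + s * f v < u := by
          intro s hs
          have := hf1 (x + s • v) (by
            rw [Metric.mem_ball, dist_eq_norm, add_sub_cancel_left, norm_smul, hv,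
              Real.norm_eq_abs, hs]
            linarith)
          rwa [map_add, map_smul, smul_eq_mul] at this
        have b1 := hb δ (abs_of_pos hδ0)
        have b2 := hb (-δ) (by rw [abs_neg, abs_of_pos hδ0])
        rw [le_div_iff₀ hδ0, Real.norm_eq_abs]
        rcases abs_cases (f v) with ⟨h, _⟩ | ⟨h, _⟩ <;> rw [h] <;> linarith
    have hfpos : 0 < ‖f‖ := by
      by_contra hneg
      have b1 := hf1 x (Metric.mem_ball_self hε)
      have b2 := hf2 y hyC
      have b3 := f.le_opNorm (y - x)
      have b4 : ‖f‖ * ‖y - x‖ ≤ 0 :=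
        mul_nonpos_of_nonpos_of_nonneg (not_lt.1 hneg) (norm_nonneg _)
      rw [map_sub, Real.norm_eq_abs] at b3
      have b5 := le_abs_self (f y - f x)
      linarith
    have hgle : ∀ v, |(‖f‖⁻¹ • f) v| ≤ ‖v‖ := by
      intro v
      have := f.le_opNorm v
      change |‖f‖⁻¹ * f v| ≤ ‖v‖
      rw [abs_mul, abs_of_pos (inv_pos.2 hfpos), inv_mul_le_iff₀ hfpos]
      exact this
    obtain ⟨p, hp, q, hq, hpq⟩ := ball_rep (‖f‖⁻¹ • f)
      (ContinuousLinearMap.opNorm_le_bound _ zero_le_one (fun v => by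
        rw [one_mul]; exact hgle v))
    have hge : ∀ w ∈ C, ‖f‖⁻¹ * u ≤ (‖f‖⁻¹ • f) w := fun w hw =>
      mul_le_mul_of_nonneg_left (hf2 w hw) (inv_nonneg.2 hfpos.le)
    have hR0 : (0 : ℝ) ≤ R := Nat.cast_nonneg R
    have haR : ‖f‖⁻¹ * u ≤ R :=
      (hge y hyC).trans ((le_abs_self _).trans ((hgle y).trans hyR))
    refine ⟨⟨⟨p, hp⟩, ⟨q, hq⟩, ⟨max (‖f‖⁻¹ * u) (-R), le_max_right _ _,
      max_le haR (by linarith)⟩⟩, ⟨⟨_, rfl⟩, {C}, by simpa using hC, countable_singleton C, ?_⟩, ?_⟩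
    · intro w hw hwR
      simp only [Φ]
      rw [← hpq, sub_nonneg]
      exact max_le (hge w (hw C rfl)) (by
        have := (abs_le.1 ((hgle w).trans hwR)).1
        exact this)
    · simp only [Φ]
      rw [← hpq]
      have b1 : (‖f‖⁻¹ • f) x + δ ≤ ‖f‖⁻¹ * u := by
        rw [le_div_iff₀ hδ0] at hnorm
        have : ‖f‖⁻¹ * (‖f‖ * δ) ≤ ‖f‖⁻¹ * (u - f x) :=
          mul_le_mul_of_nonneg_left hnorm (inv_nonneg.2 hfpos.le)
        rw [inv_mul_cancel_left₀ hfpos.ne', mul_sub] at this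
        change ‖f‖⁻¹ * f x + δ ≤ ‖f‖⁻¹ * u
        linarith
      have b2 := le_max_left (‖f‖⁻¹ * u) (-(R : ℝ))
      linarith
  let T : Set (C(L, ℝ) → ℝ) := {F | (∀ x, F x = F 0) ∧ F 0 ≤ -δ}
  have hTconv : Convex ℝ T := by
    intro F hF G hG a b ha hb hab
    refine ⟨fun x => by simp [hF.1 x, hG.1 x], ?_⟩
    have h1 := mul_le_mul_of_nonneg_left hF.2 ha
    have h2 := mul_le_mul_of_nonneg_left hG.2 hb
    simp only [Pi.add_apply, Pi.smul_apply, smul_eq_mul]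
    have : -δ = a * -δ + b * -δ := by rw [← add_mul, hab, one_mul]
    linarith
  have hTcl : IsClosed T := by
    have : T = (⋂ x, {F | F x = F 0}) ∩ {F | F 0 ≤ -δ} := by
      ext F; simp [T]
    rw [this]
    exact (isClosed_iInter fun x => isClosed_eq (by fun_prop) (by fun_prop)).inter
      (isClosed_le (by fun_prop) continuous_const)
  have hclW : closure 𝒜 ⊆ range Φ := closure_minimal h𝒜W hWc.isClosed
  by_cases hdisj : Disjoint (closure 𝒜) T
  · obtain ⟨l, u, v, hl1, huv, hl2⟩ := geometric_hahn_banach_compact_closed h𝒜conv.closure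
      (hWc.of_isClosed_subset isClosed_closure hclW) hTconv hTcl hdisj
    obtain ⟨J, c, hc⟩ := dual_pi l
    set y : C(L, ℝ) := ∑ j ∈ J, c j • j with hy
    set t : ℝ := ∑ j ∈ J, c j with ht
    have hlΦ : ∀ z, l (Φ z) = z.1.1 y - z.2.1.1 y - t * z.2.2.1 := by
      intro z
      rw [hc, hy, z.1.2.1.sum, z.2.1.2.1.sum, ht, Finset.sum_mul, ← Finset.sum_sub_distrib,
        ← Finset.sum_sub_distrib]
      refine Finset.sum_congr rfl fun j _ => ?_
      rw [z.1.2.1.smul, z.2.1.2.1.smul]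
      simp only [Φ]
      ring
    have hlT : ∀ b, δ ≤ b → v < -(t * b) := by
      intro b hb
      have := hl2 (fun _ => -b) ⟨fun _ => rfl, by simpa using hb⟩
      rw [hc, ← Finset.sum_mul, ← ht] at this
      linarith
    have hlA : ∀ z, Φ z ∈ 𝒜 → l (Φ z) < u := fun z hz => hl1 _ (subset_closure hz)
    rcases lt_trichotomy t 0 with ht0 | ht0 | ht0
    · obtain ⟨z, hz, hzx⟩ := hsep (t⁻¹ • y)
      have h1 := hlA z hz
      rw [hlΦ] at h1
      have h2 := hlT δ le_rfl
      simp only [Φ] at hzx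
      rw [z.1.2.1.smul, z.2.1.2.1.smul] at hzx
      have h3 : t * (-δ) ≤ t * (t⁻¹ * z.1.1 y - t⁻¹ * z.2.1.1 y - z.2.2.1) :=
        mul_le_mul_of_nonpos_left hzx ht0.le
      rw [mul_sub, mul_sub, mul_inv_cancel_left₀ ht0.ne, mul_inv_cancel_left₀ ht0.ne] at h3
      linarith
    · have h2 := hlT δ le_rfl
      rw [ht0, zero_mul, neg_zero] at h2
      have hu : 0 < -u := by linarith
      obtain ⟨n, hn⟩ := exists_nat_gt ((R : ℝ) / (-u))
      rw [div_lt_iff₀ hu] at hn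
      obtain ⟨z, hz, hzx⟩ := hsep ((-(n : ℝ)) • y)
      have h1 := hlA z hz
      rw [hlΦ, ht0, zero_mul, sub_zero] at h1
      simp only [Φ] at hzx
      rw [z.1.2.1.smul, z.2.1.2.1.smul] at hzx
      have h4 := z.2.2.2.2
      have h5 : (n : ℝ) * (z.1.1 y - z.2.1.1 y) ≤ n * u :=
        mul_le_mul_of_nonneg_left h1.le (Nat.cast_nonneg n)
      linarith
    · have h1 := hlT (max δ (-v / t)) (le_max_left _ _)
      have h2 : t * (-v / t) ≤ t * max δ (-v / t) :=
        mul_le_mul_of_nonneg_left (le_max_right _ _) ht0.le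
      rw [mul_div_cancel₀ _ ht0.ne'] at h2
      linarith
  · rw [not_disjoint_iff] at hdisj
    obtain ⟨F, hF, hFT⟩ := hdisj
    obtain ⟨B, hB, hBc, hFB⟩ := hWt 𝒜 h𝒜W F (hclW hF) hF
    choose D hD hDc hDx using fun G : B => (hB G.2).2
    have := hBc.to_subtype
    obtain ⟨x, hx, hxR⟩ := hR (⋃ G, D G) (iUnion_subset hD) (countable_iUnion hDc)
    have h1 : IsClosed {G : C(L, ℝ) → ℝ | 0 ≤ G x} := isClosed_le continuous_const (by fun_prop)
    have h2 : F ∈ {G : C(L, ℝ) → ℝ | 0 ≤ G x} := by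
      refine closure_minimal ?_ h1 hFB
      intro G hG
      exact hDx ⟨G, hG⟩ x (fun C hC => hx C (mem_iUnion.2 ⟨⟨G, hG⟩, hC⟩)) hxR
    have h3 : 0 ≤ F x := h2
    rw [hFT.1] at h3
    linarith [hFT.2]

lemma claim2 {L : Type*} [TopologicalSpace L] [CompactSpace L] [Nonempty L]
    (h : CountablyTight (P1 L)) (𝒞 : Set (Set C(L, ℝ))) (hcc : ∀ C ∈ 𝒞, Convex ℝ C)
    (S : Set C(L, ℝ)) (hS : Convex ℝ S)
    (hcip : ∀ 𝒟 ⊆ 𝒞, 𝒟.Countable → (⋂₀ 𝒟 ∩ S).Nonempty) (ε : ℝ) (hε : 0 < ε) :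
    ∃ x, ∀ 𝒟 ⊆ 𝒞, 𝒟.Countable → (⋂₀ 𝒟 ∩ S ∩ Metric.closedBall x ε).Nonempty := by
  obtain ⟨x, hx⟩ := claim1 h {E | ∃ 𝒟 ⊆ 𝒞, 𝒟.Countable ∧ E = ⋂₀ 𝒟 ∩ S} (by
      rintro _ ⟨D, hD, hDc, rfl⟩
      exact (convex_sInter fun C hC => hcc C (hD hC)).inter hS) (by
      intro F hF hFc
      choose D hD hDc hDE using fun E : F => hF E.2
      have := hFc.to_subtype
      obtain ⟨x, hx, hxS⟩ := hcip (⋃ E, D E) (iUnion_subset hD) (countable_iUnion hDc)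
      refine ⟨x, fun E hE => ?_⟩
      have h1 := hDE ⟨E, hE⟩
      simp only at h1
      rw [h1]
      exact ⟨fun C hC => hx C (mem_iUnion.2 ⟨⟨E, hE⟩, hC⟩), hxS⟩) ε hε
  refine ⟨x, fun D hD hDc => ?_⟩
  obtain ⟨y, hy, hyx⟩ := hx _ ⟨D, hD, hDc, rfl⟩
  exact ⟨y, hy, hyx.le⟩

lemma C_of_tight {L : Type*} [TopologicalSpace L] [CompactSpace L] [Nonempty L]
    (h : CountablyTight (P1 L)) : PropertyC C(L, ℝ) := by
  intro 𝒞 hcc hcip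
  let Q : C(L, ℝ) → ℝ → Prop := fun x r =>
    ∀ 𝒟 ⊆ 𝒞, 𝒟.Countable → (⋂₀ 𝒟 ∩ Metric.closedBall x r).Nonempty
  have hcv : ∀ C ∈ 𝒞, Convex ℝ C := fun C hC => (hcc C hC).2
  obtain ⟨x0, hx0⟩ : ∃ x0, Q x0 ((1 / 2) ^ 0) := by
    obtain ⟨x, hx⟩ := claim2 h 𝒞 hcv univ convex_univ (by simpa using hcip) 1 one_pos
    refine ⟨x, ?_⟩
    simpa [Q] using hx
  have hstep : ∀ (n : ℕ) (x : {x // Q x ((1 / 2) ^ n)}),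
      ∃ x' : {x // Q x ((1 / 2) ^ (n + 1))}, dist x.1 x'.1 ≤ 2 * (1 / 2) ^ n := by
    rintro n ⟨x, hx⟩
    obtain ⟨x', hx'⟩ := claim2 h 𝒞 hcv (Metric.closedBall x ((1 / 2) ^ n)) (convex_closedBall _ _)
      hx ((1 / 2) ^ (n + 1)) (by positivity)
    refine ⟨⟨x', fun D hD hDc => ?_⟩, ?_⟩
    · obtain ⟨y, ⟨hy1, hy2⟩, hy3⟩ := hx' D hD hDc
      exact ⟨y, hy1, hy3⟩
    · obtain ⟨y, ⟨hy1, hy2⟩, hy3⟩ := hx' ∅ (empty_subset _) countable_empty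
      rw [Metric.mem_closedBall] at hy2 hy3
      have h1 := dist_triangle_left x x' y
      have h2 : (1 / 2 : ℝ) ^ (n + 1) ≤ (1 / 2) ^ n :=
        pow_le_pow_of_le_one (by norm_num) (by norm_num) (Nat.le_succ n)
      simp only
      linarith
  choose next hnext using hstep
  let seq : (n : ℕ) → {x // Q x ((1 / 2) ^ n)} := fun n =>
    Nat.rec (motive := fun n => {x // Q x ((1 / 2) ^ n)}) ⟨x0, hx0⟩ (fun n x => next n x) n
  have hdist : ∀ n, dist (seq n).1 (seq (n + 1)).1 ≤ 2 * (1 / 2) ^ n := fun n => hnext n (seq n)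
  have hcau : CauchySeq fun n => (seq n).1 :=
    cauchySeq_of_le_geometric (1 / 2) 2 (by norm_num) hdist
  obtain ⟨x, hx⟩ := cauchySeq_tendsto_of_complete hcau
  refine ⟨x, fun C hC => ?_⟩
  have hy : ∀ n, ∃ y ∈ C, dist y (seq n).1 ≤ (1 / 2) ^ n := by
    intro n
    obtain ⟨y, hy1, hy2⟩ := (seq n).2 {C} (by simpa using hC) (countable_singleton C)
    exact ⟨y, hy1 C rfl, hy2⟩
  choose y hyC hyd using hy
  have hpow : Filter.Tendsto (fun n : ℕ => (1 / 2 : ℝ) ^ n) Filter.atTop (nhds 0) :=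
    tendsto_pow_atTop_nhds_zero_of_lt_one (by norm_num) (by norm_num)
  have hyx : Filter.Tendsto y Filter.atTop (nhds x) := by
    refine (tendsto_iff_of_dist ?_).2 hx
    exact squeeze_zero (fun n => dist_nonneg) hyd hpow
  exact (hcc C hC).1.mem_of_tendsto hyx (Filter.Eventually.of_forall hyC)

/-- `P(K × K)` has countable tightness iff `C(K × K)` has property (C) of Corson. -/
theorem stmt4 (K : Type*) [TopologicalSpace K] [CompactSpace K] [T2Space K] :
    CountablyTight (RadonProb (K × K)) ↔ PropertyC C(K × K, ℝ) := by
  rw [tight_iff]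
  constructor
  · intro h
    rcases isEmpty_or_nonempty K with hK | hK
    · intro 𝒞 _ hcip
      refine ⟨0, fun C hC => ?_⟩
      obtain ⟨x, hx⟩ := hcip {C} (by simpa using hC) (countable_singleton C)
      have : x = 0 := by ext z; exact (IsEmpty.false z.1).elim
      rw [← this]; exact hx C rfl
    · exact C_of_tight (tight_P1 h)
  · intro hC
    exact tight_of_C hC fun s hs => countable_type_prod hC hs
end
end

section
/- If a compact Hausdorff space K carries a Radon probability measure of uncountable Maharam type, then there exists a Radon probability measure μ ∈ P(K) which is homogeneous of Maharam type ω₁ (i.e. the Maharam type of μ is ℵ₁ and the Maharam type of the restriction of μ to B is ℵ₁ for every Borel set B with μ(B) > 0). -/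
open MeasureTheory Set

noncomputable section

/-- `𝒞` is a family of measurable sets approximating every measurable set. -/
def ApproxFam {K : Type*} {m : MeasurableSpace K} (μ : Measure K) (𝒞 : Set (Set K)) : Prop :=
  (∀ C ∈ 𝒞, MeasurableSet C) ∧
    ∀ B : Set K, MeasurableSet B → ∀ ε : ENNReal, 0 < ε → ∃ C ∈ 𝒞, μ (symmDiff B C) < ε

theorem approxFam_mono {K : Type*} {m : MeasurableSpace K} {μ ν : Measure K} {𝒞 : Set (Set K)}
    {c : ENNReal} (hc : c ≠ ⊤) (hle : ∀ s, MeasurableSet s → ν s ≤ c * μ s)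
    (h : ApproxFam μ 𝒞) : ApproxFam ν 𝒞 := by
  refine ⟨h.1, fun B hB ε hε => ?_⟩
  by_cases hc0 : c = 0
  · obtain ⟨C, hC, -⟩ := h.2 B hB 1 one_pos
    refine ⟨C, hC, lt_of_le_of_lt (hle _ (hB.symmDiff (h.1 C hC))) ?_⟩
    simpa [hc0] using hε
  · obtain ⟨C, hC, hlt⟩ := h.2 B hB (ε / c) (ENNReal.div_pos hε.ne' hc)
    refine ⟨C, hC, lt_of_le_of_lt (hle _ (hB.symmDiff (h.1 C hC))) ?_⟩
    rw [mul_comm]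
    exact (ENNReal.lt_div_iff_mul_lt (Or.inl hc0) (Or.inl hc)).1 hlt

theorem countableType_mono {K : Type*} {m : MeasurableSpace K} {μ ν : Measure K}
    {c : ENNReal} (hc : c ≠ ⊤) (hle : ∀ s, MeasurableSet s → ν s ≤ c * μ s)
    (h : HasCountableType μ) : HasCountableType ν := by
  obtain ⟨𝒞, h1, h2⟩ := h
  exact ⟨𝒞, h1, approxFam_mono hc hle h2⟩

theorem maharamType_eq_aleph_one {K : Type*} {m : MeasurableSpace K} {μ : Measure K}
    (h : ¬ HasCountableType μ) {𝒞 : Set (Set K)} (hcard : Cardinal.mk 𝒞 ≤ Cardinal.aleph 1)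
    (h𝒞 : ApproxFam μ 𝒞) : maharamType μ = Cardinal.aleph 1 := by
  apply le_antisymm
  · refine le_trans (csInf_le' ?_) hcard
    exact ⟨𝒞, rfl, h𝒞⟩
  · refine le_csInf ⟨_, 𝒞, rfl, h𝒞⟩ ?_
    rintro κ ⟨𝒟, rfl, h𝒟⟩
    by_contra hlt
    rw [not_le] at hlt
    apply h
    refine ⟨𝒟, ?_, h𝒟⟩
    rw [← Cardinal.le_aleph0_iff_set_countable]
    rw [← Cardinal.succ_aleph0] at hlt
    exact Order.lt_succ_iff.1 hlt

theorem countableType_union {K : Type*} {m : MeasurableSpace K} {μ : Measure K} {D E : Set K}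
    (hD : MeasurableSet D) (h1 : HasCountableType (μ.restrict D))
    (h2 : HasCountableType (μ.restrict E)) : HasCountableType (μ.restrict (D ∪ E)) := by
  obtain ⟨𝒞, c1, m1, a1⟩ := h1
  obtain ⟨𝒟, c2, m2, a2⟩ := h2
  refine ⟨(fun p : Set K × Set K => (p.1 ∩ D) ∪ (p.2 \ D)) '' (𝒞 ×ˢ 𝒟), (c1.prod c2).image _, ?_, ?_⟩
  · rintro _ ⟨⟨a, b⟩, ⟨ha, hb⟩, rfl⟩
    exact ((m1 a ha).inter hD).union ((m2 b hb).diff hD)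
  · intro B hB ε hε
    obtain ⟨a, ha, hae⟩ := a1 B hB (ε / 2) (ENNReal.half_pos hε.ne')
    obtain ⟨b, hb, hbe⟩ := a2 B hB (ε / 2) (ENNReal.half_pos hε.ne')
    refine ⟨_, ⟨(a, b), ⟨ha, hb⟩, rfl⟩, ?_⟩
    rw [Measure.restrict_apply (hB.symmDiff (m1 a ha))] at hae
    rw [Measure.restrict_apply (hB.symmDiff (m2 b hb))] at hbe
    rw [Measure.restrict_apply (hB.symmDiff (((m1 a ha).inter hD).union ((m2 b hb).diff hD)))]
    calc _ ≤ μ ((symmDiff B a ∩ D) ∪ (symmDiff B b ∩ E)) := by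
            apply measure_mono
            intro x
            simp only [Set.mem_inter_iff, Set.mem_union, Set.mem_symmDiff, Set.mem_sdiff]
            tauto
      _ ≤ _ := measure_union_le _ _
      _ < ε / 2 + ε / 2 := ENNReal.add_lt_add hae hbe
      _ = ε := ENNReal.add_halves ε

theorem countableType_iUnion {K : Type*} {m : MeasurableSpace K} {μ : Measure K}
    [IsFiniteMeasure μ] {D : ℕ → Set K} (hmono : Monotone D)
    (hD : ∀ n, MeasurableSet (D n)) (h : ∀ n, HasCountableType (μ.restrict (D n))) :
    HasCountableType (μ.restrict (⋃ n, D n)) := by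
  choose 𝒞 hc hm ha using h
  refine ⟨⋃ n, 𝒞 n, Set.countable_iUnion hc, ?_, ?_⟩
  · intro C hC
    obtain ⟨n, hn⟩ := Set.mem_iUnion.1 hC
    exact hm n C hn
  · intro B hB ε hε
    have hU : MeasurableSet (⋃ n, D n) := MeasurableSet.iUnion hD
    have ht : Filter.Tendsto (fun n => μ ((⋃ n, D n) \ D n)) Filter.atTop (nhds 0) := by
      have := tendsto_measure_iInter_atTop (μ := μ) (s := fun n => (⋃ n, D n) \ D n)
        (fun n => (hU.diff (hD n)).nullMeasurableSet)
        (fun i j hij => Set.sdiff_subset_sdiff_right (hmono hij)) ⟨0, measure_ne_top _ _⟩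
      have he : (⋂ n, (⋃ n, D n) \ D n) = ∅ := by
        ext x; simp only [Set.mem_iInter, Set.mem_sdiff, Set.mem_iUnion, Set.mem_empty_iff_false]
        constructor
        · intro hx
          obtain ⟨⟨n, hn⟩, -⟩ := hx 0
          exact (hx n).2 hn
        · exact False.elim
      rwa [he, measure_empty] at this
    obtain ⟨n, hn⟩ := (ht.eventually (gt_mem_nhds (ENNReal.half_pos hε.ne'))).exists
    obtain ⟨C, hC, hCe⟩ := ha n B hB (ε / 2) (ENNReal.half_pos hε.ne')
    refine ⟨C, Set.mem_iUnion.2 ⟨n, hC⟩, ?_⟩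
    rw [Measure.restrict_apply (hB.symmDiff (hm n C hC))] at hCe ⊢
    calc _ ≤ μ ((symmDiff B C ∩ D n) ∪ ((⋃ n, D n) \ D n)) := by
            apply measure_mono
            intro x
            simp only [Set.mem_inter_iff, Set.mem_union, Set.mem_sdiff]
            tauto
      _ ≤ _ := measure_union_le _ _
      _ < ε / 2 + ε / 2 := ENNReal.add_lt_add hCe hn
      _ = ε := ENNReal.add_halves ε

/-- Exhaustion: a finite measure of uncountable type has a piece which is nowhere of
countable type. -/
theorem exists_nowhere_countableType {K : Type*} {m : MeasurableSpace K} {μ : Measure K}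
    [IsFiniteMeasure μ] (h : ¬ HasCountableType μ) :
    ∃ B₀, MeasurableSet B₀ ∧ 0 < μ B₀ ∧
      ∀ B, MeasurableSet B → 0 < μ (B ∩ B₀) → ¬ HasCountableType (μ.restrict (B ∩ B₀)) := by
  let 𝒟 : Set (Set K) := {D | MeasurableSet D ∧ HasCountableType (μ.restrict D)}
  have h0 : ∅ ∈ 𝒟 := by
    refine ⟨MeasurableSet.empty, {∅}, Set.countable_singleton _, ?_, ?_⟩
    · rintro C rfl; exact MeasurableSet.empty
    · intro B hB ε hε
      exact ⟨∅, rfl, by simpa using hε⟩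
  obtain ⟨u, -, hut, hu⟩ := exists_seq_tendsto_sSup (S := μ '' 𝒟) ⟨_, ∅, h0, rfl⟩ (OrderTop.bddAbove _)
  choose D hD hDu using hu
  let E : ℕ → Set K := fun n => Nat.rec (D 0) (fun k s => s ∪ D (k + 1)) n
  have hE : ∀ n, E n ∈ 𝒟 := by
    intro n
    induction n with
    | zero => exact hD 0
    | succ k ih =>
      exact ⟨ih.1.union (hD (k + 1)).1, countableType_union ih.1 ih.2 (hD (k + 1)).2⟩
  have hEm : Monotone E := monotone_nat_of_le_succ fun n => Set.subset_union_left
  have hDE : ∀ n, D n ⊆ E n := by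
    intro n
    cases n with
    | zero => exact subset_rfl
    | succ k => exact Set.subset_union_right
  have hU : (⋃ n, E n) ∈ 𝒟 :=
    ⟨MeasurableSet.iUnion fun n => (hE n).1, countableType_iUnion hEm (fun n => (hE n).1)
      fun n => (hE n).2⟩
  have hmax : ∀ F ∈ 𝒟, μ F ≤ μ (⋃ n, E n) := by
    intro F hF
    refine (le_sSup (Set.mem_image_of_mem μ hF)).trans (le_of_tendsto' hut fun n => ?_)
    rw [← hDu n]
    exact measure_mono ((hDE n).trans (Set.subset_iUnion E n))
  refine ⟨(⋃ n, E n)ᶜ, hU.1.compl, ?_, ?_⟩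
  · rw [pos_iff_ne_zero]
    intro hz
    apply h
    have : μ.restrict (⋃ n, E n) = μ := by
      apply Measure.restrict_eq_self_of_ae_mem
      exact mem_ae_iff.2 hz
    rw [← this]
    exact hU.2
  · intro B hB hpos hct
    have hBm := hB.inter hU.1.compl
    have := hmax ((⋃ n, E n) ∪ (B ∩ (⋃ n, E n)ᶜ))
      ⟨hU.1.union hBm, countableType_union hU.1 hU.2 hct⟩
    rw [measure_union (by
      rw [Set.disjoint_left]; intro x hx hx2; exact hx2.2 hx) hBm] at this
    exact absurd this (not_le.2 (ENNReal.lt_add_right (measure_ne_top _ _) hpos.ne'))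

open Cardinal in
theorem mk_generateSetAlgebra_le {α : Type*} {G : Set (Set α)} (hG : #G ≤ aleph 1) :
    #(generateSetAlgebra G) ≤ aleph 1 := by
  classical
  let G' : Set (Set α) := (G ∪ compl '' G) 
  have hG' : #G' ≤ aleph 1 := by
    refine (mk_union_le _ _).trans ?_
    exact (add_le_add hG (mk_image_le.trans hG)).trans (by rw [add_eq_self (aleph0_le_aleph 1)])
  have key : ∀ (β : Type _), #β ≤ aleph 1 → #(Finset β) ≤ aleph 1 := by
    intro β hβ
    cases finite_or_infinite β
    · have := Fintype.ofFinite β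
      exact (mk_le_aleph0).trans (aleph0_le_aleph 1)
    · rw [mk_finset_of_infinite]; exact hβ
  have h2 := key _ (key _ hG')
  refine le_trans ?_ h2
  let F : Finset (Finset G') → Set α := fun A => ⋃ a ∈ A, ⋂ t ∈ a, (t : Set α)
  have : generateSetAlgebra G ⊆ Set.range F := by
    intro s hs
    obtain ⟨A, hA, hAf, hAm, rfl⟩ := mem_generateSetAlgebra_elim hs
    let I : Set (Set α) → Finset G' := fun a =>
      if h : a.Finite then h.toFinset.subtype (· ∈ G') else ∅
    refine ⟨hA.toFinset.image I, ?_⟩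
    ext x
    simp only [F, Set.mem_iUnion, Set.mem_iInter, Finset.mem_image, Set.Finite.mem_toFinset]
    constructor
    · rintro ⟨_, ⟨a, ha, rfl⟩, hx⟩
      refine ⟨a, ha, fun t ht => ?_⟩
      have htG : t ∈ G' := by
        rcases hAm a ha t ht with h | h
        · exact Or.inl h
        · exact Or.inr ⟨_, h, compl_compl t⟩
      refine hx ⟨t, htG⟩ ?_
      simp [I, hAf a ha, ht]
    · rintro ⟨a, ha, hx⟩
      refine ⟨I a, ⟨a, ha, rfl⟩, fun t ht => hx t ?_⟩
      simpa [I, hAf a ha] using ht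
  exact (mk_le_mk_of_subset this).trans mk_range_le

theorem isSeparable_of_countableType {K : Type*} {m : MeasurableSpace K} {μ : Measure K}
    (h : HasCountableType μ) : MeasureTheory.IsSeparable μ := by
  obtain ⟨𝒞, hc, hm, ha⟩ := h
  exact ⟨𝒞, hc, hm, fun s hs _ ε hε => ha s hs _ (ENNReal.ofReal_pos.2 hε)⟩

theorem countableType_of_secondCountable {K : Type*} {m : MeasurableSpace K} {μ : Measure K}
    [IsFiniteMeasure μ] (h : SecondCountableTopology (Lp ℝ 1 μ)) : HasCountableType μ := by
  let Φ : {s : Set K // MeasurableSet s} → Lp ℝ 1 μ :=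
    fun s => indicatorConstLp 1 s.2 (measure_ne_top μ s.1) (1 : ℝ)
  have hsep : TopologicalSpace.IsSeparable (Set.range Φ) := TopologicalSpace.IsSeparable.of_separableSpace _
  obtain ⟨t, ht, htc, hd⟩ := hsep.exists_countable_dense_subset
  have ht2 : ∀ y : Lp ℝ 1 μ, ∃ s, y ∈ t → Φ s = y := by
    intro y
    by_cases hy : y ∈ t
    · obtain ⟨s, hs⟩ := ht hy
      exact ⟨s, fun _ => hs⟩
    · exact ⟨⟨∅, MeasurableSet.empty⟩, fun h => absurd h hy⟩
  choose ψ hψ using ht2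
  refine ⟨(fun y => (ψ y).1) '' t, htc.image _, ?_, ?_⟩
  · rintro _ ⟨y, -, rfl⟩; exact (ψ y).2
  · intro B hB ε hε
    have hB' := hd ⟨⟨B, hB⟩, rfl⟩
    rw [EMetric.mem_closure_iff] at hB'
    obtain ⟨y, hy, hlt⟩ := hB' ε hε
    refine ⟨_, ⟨y, hy, rfl⟩, ?_⟩
    rw [← hψ y hy] at hlt
    simp only [Φ] at hlt
    rw [edist_indicatorConstLp_eq_enorm] at hlt
    rw [Lp.enorm_def, eLpNorm_congr_ae indicatorConstLp_coeFn,
      eLpNorm_indicator_const (hB.symmDiff (ψ y).2) (by simp) (by simp)] at hlt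
    simpa using hlt

theorem exists_separated {K : Type*} [TopologicalSpace K] [CompactSpace K] [T2Space K]
    [MeasurableSpace K] [BorelSpace K] {μ : Measure K} [IsFiniteMeasure μ] [μ.InnerRegular]
    (h : ¬ HasCountableType μ) :
    ∃ ε : ℝ, 0 < ε ∧ ∃ T : Set C(K, ℝ), ¬ T.Countable ∧
      ∀ f ∈ T, ∀ g ∈ T, f ≠ g → ε ≤ ∫ x, |f x - g x| ∂μ := by
  by_contra hcon
  push Not at hcon
  apply h
  apply countableType_of_secondCountable
  let L := (ContinuousMap.toLp 1 μ ℝ : C(K, ℝ) →L[ℝ] Lp ℝ 1 μ)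
  have hL : DenseRange L := ContinuousMap.toLp_denseRange ℝ μ ℝ (by simp)
  have hdist : ∀ f g : C(K, ℝ), dist (L f) (L g) = ∫ x, |f x - g x| ∂μ := by
    intro f g
    rw [dist_eq_norm, ← map_sub, L1.norm_eq_integral_norm]
    apply integral_congr_ae
    filter_upwards [ContinuousMap.coeFn_toLp (p := 1) (𝕜 := ℝ) μ (f - g)] with x hx
    simp only [L, hx]; simp
  apply Metric.secondCountable_of_almost_dense_set
  intro ε hε
  obtain ⟨T, hT⟩ := zorn_subset {T : Set C(K, ℝ) | ∀ f ∈ T, ∀ g ∈ T, f ≠ g →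
      ε / 2 ≤ ∫ x, |f x - g x| ∂μ} (by
    intro c hc hch
    refine ⟨⋃₀ c, ?_, fun s hs => Set.subset_sUnion_of_mem hs⟩
    rintro f ⟨s, hs, hf⟩ g ⟨t, ht, hg⟩ hne
    rcases hch.total hs ht with hst | hst
    · exact hc ht f (hst hf) g hg hne
    · exact hc hs f hf g (hst hg) hne)
  have hTc : T.Countable := by
    by_contra hn
    obtain ⟨f, hf, g, hg, hne, hlt⟩ := hcon (ε / 2) (half_pos hε) T hn
    exact absurd (hT.prop f hf g hg hne) (not_le.2 hlt)
  refine ⟨L '' T, hTc.image _, fun x => ?_⟩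
  obtain ⟨f, hf⟩ := hL.exists_dist_lt x (half_pos hε)
  have : ∃ g ∈ T, dist (L f) (L g) < ε / 2 := by
    by_contra hno
    push Not at hno
    have hfT : f ∉ T := by
      intro hfT
      have := hno f hfT
      rw [dist_self] at this
      linarith
    have hins : insert f T ⊆ T := hT.le_of_ge (y := insert f T) (by
      rintro a (rfl | ha) b (rfl | hb) hne
      · exact absurd rfl hne
      · rw [← hdist]; exact hno b hb
      · rw [← hdist, dist_comm]; exact hno a ha
      · exact hT.prop a ha b hb hne) (Set.subset_insert _ _)
    exact hfT (hins (Set.mem_insert _ _))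
  obtain ⟨g, hg, hlt⟩ := this
  refine ⟨L g, ⟨g, hg, rfl⟩, ?_⟩
  linarith [dist_triangle x (L f) (L g)]

theorem not_countableType_of_separated {K : Type*} [TopologicalSpace K] [CompactSpace K] [T2Space K]
    [MeasurableSpace K] [BorelSpace K] {μ : Measure K} [IsFiniteMeasure μ]
    {ε : ℝ} (hε : 0 < ε) {T : Set C(K, ℝ)} (hT : ¬ T.Countable)
    (hs : ∀ f ∈ T, ∀ g ∈ T, f ≠ g → ε ≤ ∫ x, |f x - g x| ∂μ) : ¬ HasCountableType μ := by
  intro h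
  have := isSeparable_of_countableType h
  have : Fact ((1 : ENNReal) ≠ ⊤) := ⟨by simp⟩
  have : SecondCountableTopology (Lp ℝ 1 μ) := inferInstance
  let L := (ContinuousMap.toLp 1 μ ℝ : C(K, ℝ) →L[ℝ] Lp ℝ 1 μ)
  have hdist : ∀ f g : C(K, ℝ), dist (L f) (L g) = ∫ x, |f x - g x| ∂μ := by
    intro f g
    rw [dist_eq_norm, ← map_sub, L1.norm_eq_integral_norm]
    apply integral_congr_ae
    filter_upwards [ContinuousMap.coeFn_toLp (p := 1) (𝕜 := ℝ) μ (f - g)] with x hx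
    simp only [L, hx]; simp
  apply hT
  obtain ⟨D, hDc, hDd⟩ := TopologicalSpace.exists_countable_dense (Lp ℝ 1 μ)
  have : ∀ f : C(K, ℝ), ∃ d ∈ D, dist (L f) d < ε / 2 := fun f => hDd.exists_dist_lt _ (half_pos hε)
  choose r hr hrd using this
  refine Set.MapsTo.countable_of_injOn (f := r) (fun f _ => hr f) ?_ hDc
  intro f hf g hg hfg
  by_contra hne
  have h1 := hs f hf g hg hne
  rw [← hdist] at h1
  have h2 := hrd f
  have h3 := hrd g
  rw [← hfg] at h3
  linarith [dist_triangle_right (L f) (L g) (r f)]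

theorem exists_measure_of_functional {K : Type*} [TopologicalSpace K] [CompactSpace K] [T2Space K]
    [MeasurableSpace K] [BorelSpace K] (φ : C(K, ℝ) →ₗ[ℝ] ℝ) (hφ : ∀ f, 0 ≤ f → 0 ≤ φ f) :
    ∃ ν : Measure K, ν.InnerRegular ∧ IsFiniteMeasure ν ∧ ∀ f : C(K, ℝ), ∫ x, f x ∂ν = φ f := by
  let Λ : CompactlySupportedContinuousMap K ℝ →ₚ[ℝ] ℝ :=
  { toFun g := φ g.toContinuousMap
    map_add' g g' := φ.map_add _ _
    map_smul' c g := φ.map_smul _ _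
    monotone' g g' hgg' := by
      have := hφ (g'.toContinuousMap - g.toContinuousMap) (by
        intro x; simpa using hgg' x)
      rw [map_sub] at this
      exact sub_nonneg.1 this }
  refine ⟨RealRMK.rieszMeasure Λ, inferInstance, inferInstance, fun g => ?_⟩
  exact RealRMK.integral_rieszMeasure Λ ⟨g, HasCompactSupport.of_compactSpace _⟩

theorem ae_zero_of_integral {K : Type*} [TopologicalSpace K] [CompactSpace K] [T2Space K]
    [MeasurableSpace K] [BorelSpace K] {μ : Measure K} [IsFiniteMeasure μ] [μ.InnerRegular]
    {h : K → ℝ} (hh : MemLp h 2 μ) (h0 : ∀ f : C(K, ℝ), ∫ x, f x * h x ∂μ = 0) : h =ᵐ[μ] 0 := by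
  have hL : DenseRange (ContinuousMap.toLp 2 μ ℝ : C(K, ℝ) →L[ℝ] Lp ℝ 2 μ) :=
    ContinuousMap.toLp_denseRange ℝ μ ℝ (by simp)
  have hz : hh.toLp h = 0 := by
    refine Dense.eq_zero_of_inner_left ℝ hL ?_
    rintro _ ⟨f, rfl⟩
    rw [L2.inner_def, ← h0 f]
    apply integral_congr_ae
    filter_upwards [ContinuousMap.coeFn_toLp (p := 2) (𝕜 := ℝ) μ f, hh.coeFn_toLp] with x hx hx2
    rw [hx, hx2]
    simp [mul_comm]
  have := hh.coeFn_toLp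
  rw [hz] at this
  exact this.symm.trans (Lp.coeFn_zero _ _ _)

theorem exists_extremal_lift {K : Type*} [TopologicalSpace K] [CompactSpace K] [T2Space K]
    (m0 : MeasurableSpace K) {m : MeasurableSpace K} [BorelSpace K] (μ : Measure K)
    [IsProbabilityMeasure μ] (hm0 : m0 ≤ m) :
    ∃ ν : Measure K, IsProbabilityMeasure ν ∧ ν.InnerRegular ∧
      (∀ a : C(K, ℝ), Measurable[m0] a → ∫ x, a x ∂ν = ∫ x, a x ∂μ) ∧
      ∀ B, MeasurableSet B → ∃ C, MeasurableSet[m0] C ∧ ν (symmDiff B C) = 0 := by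
  let S : Set (WeakDual ℝ C(K, ℝ)) := {φ | (∀ f : C(K, ℝ), 0 ≤ f → 0 ≤ φ f) ∧
    ∀ a : C(K, ℝ), Measurable[m0] a → φ a = ∫ x, a x ∂μ}
  have hInteg : ∀ (ν : Measure K) [IsFiniteMeasure ν] (f : C(K, ℝ)), Integrable f ν := by
    intro ν _ f
    exact f.continuous.integrable_of_hasCompactSupport (HasCompactSupport.of_compactSpace _)
  have hone : Measurable[m0] (1 : C(K, ℝ)) := @measurable_const _ _ _ m0 (1 : ℝ)
  have hSone : ∀ φ ∈ S, φ 1 = 1 := by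
    intro φ hφ
    rw [hφ.2 1 hone]; simp
  have hSbd : ∀ φ ∈ S, ∀ f, ‖φ f‖ ≤ 1 * ‖f‖ := by
    intro φ hφ f
    have h1 := hφ.1 (‖f‖ • 1 - f) (by
      intro x
      simpa using (le_abs_self _).trans (f.norm_coe_le_norm x))
    have h2 := hφ.1 (‖f‖ • 1 + f) (by
      intro x
      have := (neg_le_abs _).trans (f.norm_coe_le_norm x)
      simp; linarith)
    rw [map_sub, map_smul, hSone φ hφ] at h1
    rw [map_add, map_smul, hSone φ hφ] at h2
    simp only [smul_eq_mul, mul_one] at h1 h2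
    rw [Real.norm_eq_abs, abs_le]
    constructor <;> linarith
  have hScl : IsClosed S := by
    have : S = (⋂ f : C(K, ℝ), ⋂ _ : 0 ≤ f, {φ : WeakDual ℝ C(K, ℝ) | 0 ≤ φ f}) ∩
      ⋂ a : C(K, ℝ), ⋂ _ : Measurable[m0] a, {φ : WeakDual ℝ C(K, ℝ) | φ a = ∫ x, a x ∂μ} := by
      ext φ; simp [S]
    rw [this]
    refine IsClosed.inter ?_ ?_
    · exact isClosed_iInter fun f => isClosed_iInter fun _ =>
        isClosed_le continuous_const (WeakDual.eval_continuous f)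
    · exact isClosed_iInter fun f => isClosed_iInter fun _ =>
        isClosed_eq (WeakDual.eval_continuous f) continuous_const
  have hScomp : IsCompact S := by
    refine (WeakDual.isCompact_closedBall (𝕜 := ℝ) (E := C(K, ℝ)) 0 1).of_isClosed_subset hScl ?_
    intro φ hφ
    simp only [Set.mem_preimage, mem_closedBall_zero_iff]
    exact ContinuousLinearMap.opNorm_le_bound _ zero_le_one (hSbd φ hφ)
  have hSne : S.Nonempty := by
    let φ : C(K, ℝ) →ₗ[ℝ] ℝ :=
    { toFun f := ∫ x, f x ∂μ
      map_add' f g := integral_add (hInteg μ f) (hInteg μ g)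
      map_smul' c f := integral_const_mul c _ }
    let φc : C(K, ℝ) →L[ℝ] ℝ := φ.mkContinuous 1 (by
      intro f
      have := norm_integral_le_of_norm_le_const (μ := μ) (f := f) (C := ‖f‖)
        (Filter.Eventually.of_forall fun x => f.norm_coe_le_norm x)
      simpa [φ] using this)
    exact ⟨StrongDual.toWeakDual φc, fun f hf => integral_nonneg hf, fun a _ => rfl⟩
  have : LocallyConvexSpace ℝ (WeakDual ℝ C(K, ℝ)) :=
    inferInstanceAs (LocallyConvexSpace ℝ (WeakBilin (topDualPairing ℝ C(K, ℝ))))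
  obtain ⟨φ, hφ⟩ := hScomp.extremePoints_nonempty hSne
  obtain ⟨ν, hreg, hfin, hν⟩ := exists_measure_of_functional
    (φ : C(K, ℝ) →L[ℝ] ℝ).toLinearMap hφ.1.1
  have hν' : ∀ f : C(K, ℝ), ∫ x, f x ∂ν = φ f := hν
  have hprob : IsProbabilityMeasure ν := by
    have := hν' 1
    rw [hSone φ hφ.1] at this
    simp only [ContinuousMap.one_apply, integral_const, smul_eq_mul, mul_one] at this
    rw [Measure.real] at this
    exact ⟨by rwa [ENNReal.toReal_eq_one_iff] at this⟩
  refine ⟨ν, hprob, hreg, fun a ha => (hν' a).trans (hφ.1.2 a ha), fun B hB => ?_⟩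
  let b : K → ℝ := B.indicator 1
  let e : K → ℝ := ν[b | m0]
  have hbi : Integrable b ν := (integrable_const (1 : ℝ)).indicator hB
  have hei : Integrable e ν := integrable_condExp
  have he0 : ∀ᵐ x ∂ν, 0 ≤ e x :=
    condExp_nonneg (Filter.Eventually.of_forall fun x => Set.indicator_nonneg (by simp) x)
  have he1 : ∀ᵐ x ∂ν, e x ≤ 1 := by
    have := condExp_mono (m := m0) hbi (integrable_const (1 : ℝ))
      (Filter.Eventually.of_forall fun x => Set.indicator_le_self' (by simp) x)
    rwa [condExp_const hm0] at this
  let h : K → ℝ := fun x => b x - e x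
  have hhi : Integrable h ν := hbi.sub hei
  have hb : ∀ᵐ x ∂ν, ‖h x‖ ≤ 1 := by
    filter_upwards [he0, he1] with x h0 h1
    simp only [h, b, Real.norm_eq_abs, abs_le]
    by_cases hxB : x ∈ B
    · rw [Set.indicator_of_mem hxB, Pi.one_apply]
      constructor <;> linarith
    · rw [Set.indicator_of_notMem hxB]
      constructor <;> linarith
  have hfh : ∀ f : C(K, ℝ), Integrable (fun x => f x * h x) ν := fun f =>
    (hInteg ν f).mul_bdd (c := 1) hhi.aestronglyMeasurable hb
  have horth : ∀ a : C(K, ℝ), Measurable[m0] a → ∫ x, a x * h x ∂ν = 0 := by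
    intro a ha
    have hab : Integrable (fun x => a x * b x) ν :=
      hbi.bdd_mul (c := ‖a‖) (hInteg ν a).aestronglyMeasurable
        (Filter.Eventually.of_forall fun x => a.norm_coe_le_norm x)
    have hae : Integrable (fun x => a x * e x) ν :=
      hei.bdd_mul (c := ‖a‖) (hInteg ν a).aestronglyMeasurable
        (Filter.Eventually.of_forall fun x => a.norm_coe_le_norm x)
    have h1 : ν[fun x => a x * b x | m0] =ᵐ[ν] fun x => a x * e x :=
      condExp_mul_of_stronglyMeasurable_left (m := m0) ha.stronglyMeasurable hab hbi
    have h2 := integral_condExp (μ := ν) (f := fun x => a x * b x) hm0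
    rw [integral_congr_ae h1] at h2
    simp only [h, mul_sub]
    rw [integral_sub hab hae, h2, sub_self]
  let ψ : C(K, ℝ) →ₗ[ℝ] ℝ :=
    { toFun f := ∫ x, f x * h x ∂ν
      map_add' f g := by
        rw [← integral_add (hfh f) (hfh g)]
        simp [add_mul]
      map_smul' c f := by
        simp [mul_assoc, integral_const_mul] }
  have hψle : ∀ f, 0 ≤ f → ‖ψ f‖ ≤ φ f := by
    intro f hf
    rw [← hν']
    refine norm_integral_le_of_norm_le (hInteg ν f) ?_
    filter_upwards [hb] with x hx
    have hfx : 0 ≤ f x := hf x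
    rw [norm_mul, Real.norm_of_nonneg hfx]
    exact mul_le_of_le_one_right (hf x) hx
  let ψc : C(K, ℝ) →L[ℝ] ℝ := ψ.mkContinuous 1 (by
      intro f
      refine (norm_integral_le_of_norm_le_const (μ := ν) (C := ‖f‖) ?_).trans (by simp)
      filter_upwards [hb] with x hx
      rw [norm_mul]
      exact (mul_le_of_le_one_right (norm_nonneg _) hx).trans (f.norm_coe_le_norm x))
  let ψw : WeakDual ℝ C(K, ℝ) := StrongDual.toWeakDual ψc
  have hψw : ∀ f, ψw f = ψ f := fun f => rfl
  have hplus : φ + ψw ∈ S := by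
    refine ⟨fun f hf => ?_, fun a ha => ?_⟩
    · have := (abs_le.1 (hψle f hf)).1
      change 0 ≤ φ f + ψ f
      linarith
    · change φ a + ψ a = _
      rw [hφ.1.2 a ha, show ψ a = 0 from horth a ha, add_zero]
  have hminus : φ - ψw ∈ S := by
    refine ⟨fun f hf => ?_, fun a ha => ?_⟩
    · have := (abs_le.1 (hψle f hf)).2
      change 0 ≤ φ f - ψ f
      linarith
    · change φ a - ψ a = _
      rw [hφ.1.2 a ha, show ψ a = 0 from horth a ha, sub_zero]
  have hext : φ + ψw = φ := by
    refine hφ.2 hplus hminus ?_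
    refine ⟨1 / 2, 1 / 2, by norm_num, by norm_num, by norm_num, ?_⟩
    module
  have hψ0 : ψw = 0 := by simpa using hext
  have hzero : h =ᵐ[ν] 0 := by
    refine ae_zero_of_integral (MemLp.of_bound hhi.aestronglyMeasurable 1 hb) fun f => ?_
    have : ψw f = 0 := by rw [hψ0]; rfl
    exact this
  refine ⟨{x | 1 / 2 < e x}, ?_, ?_⟩
  · have : Measurable[m0] e := stronglyMeasurable_condExp.measurable
    exact this measurableSet_Ioi
  · refine measure_mono_null ?_ (ae_iff.1 hzero)
    intro x hx hx0
    simp only [h, Pi.zero_apply, sub_eq_zero] at hx0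
    simp only [Set.mem_symmDiff, Set.mem_ofPred_eq, ← hx0, b] at hx
    by_cases hxB : x ∈ B
    · simp [hxB] at hx; norm_num at hx
    · simp [hxB] at hx; norm_num at hx

theorem approx_algebra_aux {K : Type*} {m0 : MeasurableSpace K} (ρ : Measure K)
    [IsFiniteMeasure ρ] {G : Set (Set K)} (hG : m0 = MeasurableSpace.generateFrom G)
    {B : Set K} (hB : MeasurableSet B) {δ : ℝ} (hδ : 0 < δ) :
    ∃ C ∈ generateSetAlgebra G, MeasurableSet C ∧ ρ (symmDiff B C) < ENNReal.ofReal δ := by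
  have hd := Measure.MeasureDense.of_generateFrom_isSetAlgebra_finite (μ := ρ)
    (𝒜 := generateSetAlgebra G) isSetAlgebra_generateSetAlgebra
    (hG.trans generateFrom_generateSetAlgebra_eq.symm)
  obtain ⟨C, hC, hlt⟩ := hd.approx B hB (measure_ne_top _ _) δ hδ
  exact ⟨C, hC, hd.measurable C hC, hlt⟩

theorem measurable_abs_sub_aux {K : Type*} {m0 : MeasurableSpace K} {f g : K → ℝ}
    (hf : Measurable f) (hg : Measurable g) : Measurable fun x => |f x - g x| :=
  continuous_abs.measurable.comp (hf.sub hg)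

open Cardinal in
theorem exists_uncountable_small {K : Type*} [TopologicalSpace K] [CompactSpace K] [T2Space K]
    [mK : MeasurableSpace K] [BorelSpace K] (μ : Measure K) [IsProbabilityMeasure μ]
    [μ.InnerRegular] (h : ¬ HasCountableType μ) :
    ∃ ν : Measure K, IsProbabilityMeasure ν ∧ ν.InnerRegular ∧ ¬ HasCountableType ν ∧
      ∃ 𝒞 : Set (Set K), #𝒞 ≤ aleph 1 ∧ ApproxFam ν 𝒞 := by
  obtain ⟨ε, hε, T₀, hT₀, hsep₀⟩ := exists_separated h
  have hle : aleph 1 ≤ #T₀ := by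
    rw [← succ_aleph0, Order.succ_le_iff, ← not_le, le_aleph0_iff_set_countable]
    exact hT₀
  obtain ⟨T, hTT₀, hT⟩ := le_mk_iff_exists_subset.1 hle
  have hTunc : ¬ T.Countable := by
    rw [← le_aleph0_iff_set_countable, hT, not_le]
    exact aleph0_lt_aleph_one
  let G : Set (Set K) := Set.range fun p : T × ℚ => (p.1 : C(K, ℝ)) ⁻¹' Set.Ioi (p.2 : ℝ)
  have hG : #G ≤ aleph 1 := by
    refine mk_range_le.trans ?_
    rw [mk_prod, hT, Cardinal.mkRat]
    simp only [lift_aleph0, lift_uzero]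
    exact (mul_aleph0_eq (aleph0_le_aleph 1)).le
  have hGopen : ∀ s ∈ G, MeasurableSet s := by
    rintro _ ⟨p, rfl⟩
    exact (isOpen_Ioi.preimage p.1.1.continuous).measurableSet
  have hm0 : (MeasurableSpace.generateFrom G) ≤ mK := MeasurableSpace.generateFrom_le hGopen
  have hmeas : ∀ g ∈ T, Measurable[(MeasurableSpace.generateFrom G)] g := by
    intro g hg
    have hb := Real.borel_eq_generateFrom_Ioi_rat
    rw [BorelSpace.measurable_eq (α := ℝ), hb]
    refine @measurable_generateFrom _ _ (MeasurableSpace.generateFrom G) _ _ ?_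
    intro t ht
    simp only [Set.mem_iUnion, Set.mem_singleton_iff] at ht
    obtain ⟨q, rfl⟩ := ht
    exact MeasurableSpace.measurableSet_generateFrom ⟨(⟨g, hg⟩, q), rfl⟩
  obtain ⟨ν, hν1, hν2, hν3, hν4⟩ := exists_extremal_lift (MeasurableSpace.generateFrom G) μ hm0
  refine ⟨ν, hν1, hν2, ?_, generateSetAlgebra G, mk_generateSetAlgebra_le hG, ?_, ?_⟩
  · refine not_countableType_of_separated hε hTunc fun f hf g hg hne => ?_
    have hm : Measurable[(MeasurableSpace.generateFrom G)] (fun x => |f x - g x|) := by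
      exact measurable_abs_sub_aux (hmeas f hf) (hmeas g hg)
    have := hν3 ⟨fun x => |f x - g x|, by fun_prop⟩ hm
    simp only [ContinuousMap.coe_mk] at this
    rw [this]
    exact hsep₀ f (hTT₀ hf) g (hTT₀ hg) hne
  · intro C hC
    apply hm0
    have := @MeasurableSpace.measurableSet_generateFrom K (generateSetAlgebra G) C hC
    rwa [generateFrom_generateSetAlgebra_eq] at this
  · intro B hB δ hδ
    obtain ⟨B', hB', hBB'⟩ := hν4 B hB
    obtain ⟨δ', hδ'0, hδ'⟩ : ∃ δ' : ℝ, 0 < δ' ∧ ENNReal.ofReal δ' ≤ δ := by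
      by_cases ht : δ = ⊤
      · exact ⟨1, one_pos, by simp [ht]⟩
      · exact ⟨δ.toReal, ENNReal.toReal_pos hδ.ne' ht, ENNReal.ofReal_toReal_le⟩
    obtain ⟨C, hC, hCm, hlt⟩ := approx_algebra_aux (ν.trim hm0) rfl hB' hδ'0
    refine ⟨C, hC, ?_⟩
    rw [trim_measurableSet_eq hm0 (hB'.symmDiff hCm)] at hlt
    calc ν (symmDiff B C) ≤ ν (symmDiff B B') + ν (symmDiff B' C) := measure_symmDiff_le _ _ _
      _ = ν (symmDiff B' C) := by rw [hBB', zero_add]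
      _ < _ := hlt
      _ ≤ δ := hδ'

/-- If `K` carries a Radon probability measure of uncountable Maharam type, then it carries
one which is homogeneous of Maharam type `ω₁`. -/
theorem stmt6 (K : Type*) [TopologicalSpace K] [CompactSpace K] [T2Space K]
    (h : ∃ μ : RadonProb K, ¬ HasCountableType μ.1) :
    ∃ μ : RadonProb K, IsHomogeneousOmega1 μ.1 := by
  obtain ⟨⟨μ, hμ1, hμ2⟩, hμ⟩ := h
  let _ : MeasurableSpace K := borel K
  have : BorelSpace K := ⟨rfl⟩
  obtain ⟨ν, hν1, hν2, hν3, 𝒞, h𝒞, hap⟩ := exists_uncountable_small μ hμ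
  obtain ⟨B₀, hB₀, hpos, hnow⟩ := exists_nowhere_countableType hν3
  have hc0 : (ν B₀)⁻¹ ≠ 0 := ENNReal.inv_ne_zero.2 (measure_ne_top _ _)
  have hct : (ν B₀)⁻¹ ≠ ⊤ := ENNReal.inv_ne_top.2 hpos.ne'
  let ρ : Measure K := (ν B₀)⁻¹ • ν.restrict B₀
  have hρ1 : IsProbabilityMeasure ρ := ⟨by
    simp only [ρ, Measure.smul_apply, Measure.restrict_apply_univ, smul_eq_mul]
    exact ENNReal.inv_mul_cancel hpos.ne' (measure_ne_top _ _)⟩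
  have hρ2 : ρ.InnerRegular := inferInstance
  have hρ : ∀ s, MeasurableSet s → ρ s = (ν B₀)⁻¹ * ν (s ∩ B₀) := by
    intro s hs
    simp [ρ, Measure.restrict_apply hs]
  have key : ∀ B, MeasurableSet B → 0 < ρ B → maharamType (ρ.restrict B) = Cardinal.aleph 1 := by
    intro B hB hBpos
    refine maharamType_eq_aleph_one ?_ h𝒞 (approxFam_mono hct ?_ hap)
    · intro hcount
      have hB' : 0 < ν (B ∩ B₀) := by
        rw [pos_iff_ne_zero]
        intro hz
        rw [hρ B hB, hz, mul_zero] at hBpos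
        exact lt_irrefl _ hBpos
      refine hnow B hB hB' (countableType_mono (measure_ne_top ν B₀) ?_ hcount)
      intro s hs
      rw [Measure.restrict_apply hs, Measure.restrict_apply hs, hρ _ (hs.inter hB), ← mul_assoc,
        ENNReal.mul_inv_cancel hpos.ne' (measure_ne_top _ _), one_mul, Set.inter_assoc]
    · intro s hs
      rw [Measure.restrict_apply hs, hρ _ (hs.inter hB)]
      gcongr
      intro x hx
      exact hx.1.1
  refine ⟨⟨ρ, hρ1, hρ2⟩, ?_, key⟩
  have := key Set.univ MeasurableSet.univ (by simp)
  rwa [Measure.restrict_univ] at this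
end
end

section
/- Let μ be a Radon probability measure on a compact Hausdorff space K which is homogeneous of Maharam type ω₁, and let 𝒞 be a countable family of Borel subsets of K. Then there exists a Borel set B ⊆ K such that μ(B) = 1/2 and B is μ-independent of 𝒞, i.e. μ(B ∩ C) = (1/2)·μ(C) for every C ∈ 𝒞. -/
open MeasureTheory Set

noncomputable section

open scoped InnerProductSpace ENNReal in
theorem aux_h {K : Type*} {m0 : MeasurableSpace K} (ν : Measure K) [IsFiniteMeasure ν]
    (hν : maharamType ν = Cardinal.aleph 1) (𝒞 : Set (Set K)) (hc : 𝒞.Countable)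
    (hm : ∀ C ∈ 𝒞, MeasurableSet C) :
    ∃ h : K → ℝ, StronglyMeasurable h ∧ (∀ᵐ x ∂ν, |h x| ≤ 1) ∧
      (∀ C ∈ 𝒞, ∫ x in C, h x ∂ν = 0) ∧ ¬ h =ᵐ[ν] 0 := by
  by_contra hcon
  push Not at hcon
  set m := MeasurableSpace.generateFrom 𝒞 with hmdef
  have hle : m ≤ m0 := MeasurableSpace.generateFrom_le hm
  have key : ∀ D : Set K, MeasurableSet[m0] D → ∃ A : Set K, MeasurableSet[m] A ∧ D =ᵐ[ν] A := by
    intro D hD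
    have hint : Integrable (D.indicator (fun _ => (1:ℝ))) ν := (integrable_const 1).indicator hD
    set f := D.indicator (fun _ => (1:ℝ)) with hf
    have hz := hcon (fun x => f x - (ν[f|m]) x)
      (((stronglyMeasurable_const).indicator hD).sub (stronglyMeasurable_condExp.mono hle))
      (by
        have h0 : 0 ≤ᵐ[ν] ν[f|m] := condExp_nonneg (Filter.Eventually.of_forall fun x => by
          simp only [hf]; exact Set.indicator_nonneg (by simp) x)
        have h1 : ν[f|m] ≤ᵐ[ν] ν[fun _ => (1:ℝ)|m] := condExp_mono hint (integrable_const 1)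
          (Filter.Eventually.of_forall fun x => by
            simp only [hf]; exact Set.indicator_le_self' (by simp) x)
        rw [condExp_const hle] at h1
        filter_upwards [h0, h1] with x hx0 hx1
        have a0 : 0 ≤ f x := by simp only [hf]; exact Set.indicator_nonneg (by simp) x
        have a1 : f x ≤ 1 := by simp only [hf]; exact Set.indicator_le_self' (by simp) x
        simp only [Pi.zero_apply] at hx0
        rw [abs_le]; constructor <;> linarith)
      (by
        intro C hC
        have hCm : MeasurableSet[m] C := MeasurableSpace.measurableSet_generateFrom hC
        rw [integral_sub hint.integrableOn integrable_condExp.integrableOn,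
          setIntegral_condExp hle hint hCm, sub_self])
    refine ⟨(ν[f|m]) ⁻¹' {1}, stronglyMeasurable_condExp.measurable (measurableSet_singleton 1), ?_⟩
    filter_upwards [hz] with x hx
    simp only [Pi.zero_apply, sub_eq_zero] at hx
    apply propext
    change x ∈ D ↔ (ν[f|m]) x = 1
    rw [← hx, hf]
    by_cases hxD : x ∈ D <;> simp [hxD]
  have hdense := Measure.MeasureDense.of_generateFrom_isSetAlgebra_finite (m := m) (ν.trim hle)
    (isSetAlgebra_generateSetAlgebra (𝒜 := 𝒞)) (generateFrom_generateSetAlgebra_eq).symm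
  have hcount := countable_generateSetAlgebra hc
  have hle' : maharamType ν ≤ Cardinal.mk (generateSetAlgebra 𝒞) := by
    apply csInf_le'
    refine ⟨_, rfl, fun C hC => hle _ (hdense.measurable C hC), ?_⟩
    intro B hB ε hε
    obtain ⟨A, hA, hBA⟩ := key B hB
    obtain ⟨δ, hδ, hδε⟩ : ∃ δ : ℝ, 0 < δ ∧ ENNReal.ofReal δ ≤ ε := by
      obtain ⟨r, hr, hrε⟩ := ENNReal.lt_iff_exists_nnreal_btwn.1 hε
      exact ⟨r, by exact_mod_cast hr, by simpa using hrε.le⟩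
    obtain ⟨t, ht, htA⟩ := hdense.approx A hA (measure_ne_top _ _) δ hδ
    refine ⟨t, ht, ?_⟩
    rw [trim_measurableSet_eq hle (hA.symmDiff (hdense.measurable t ht))] at htA
    have hcg : ν (symmDiff B t) = ν (symmDiff A t) :=
      measure_congr (ae_eq_set_symmDiff hBA (Filter.EventuallyEq.refl _ t))
    exact hcg.trans_lt (htA.trans_le hδε)
  have h2 : Cardinal.mk (generateSetAlgebra 𝒞) ≤ Cardinal.aleph0 := hcount.le_aleph0
  rw [hν] at hle'
  exact absurd (hle'.trans h2) (not_le.2 Cardinal.aleph0_lt_aleph_one)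

theorem aux_main {K : Type*} {m0 : MeasurableSpace K} (μ : Measure K) [IsProbabilityMeasure μ]
    (hμ : ∀ B : Set K, MeasurableSet B → 0 < μ B →
      maharamType (μ.restrict B) = Cardinal.aleph 1) (𝒞 : Set (Set K)) (hc : 𝒞.Countable)
    (hm : ∀ C ∈ 𝒞, MeasurableSet C) :
    ∃ B : Set K, MeasurableSet B ∧ ∀ C ∈ 𝒞, μ (B ∩ C) = μ C / 2 := by
  let ind : ∀ B : Set K, MeasurableSet B → Lp ℝ 2 μ :=
    fun B hB => indicatorConstLp 2 hB (measure_ne_top μ B) (1:ℝ)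
  let S : Set (WeakDual ℝ (Lp ℝ 2 μ)) :=
    {φ | (∀ B (hB : MeasurableSet B), 0 ≤ φ (ind B hB) ∧ φ (ind B hB) ≤ μ.real B) ∧
      ∀ C (hC : C ∈ 𝒞), φ (ind C (hm C hC)) = μ.real C / 2}
  let Φ : Lp ℝ 2 μ → WeakDual ℝ (Lp ℝ 2 μ) :=
    fun g => StrongDual.toWeakDual (InnerProductSpace.toDual ℝ _ g)
  have hΦ : ∀ g B hB, Φ g (ind B hB) = ∫ x in B, g x ∂μ := by
    intro g B hB
    change inner ℝ g (ind B hB) = _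
    rw [real_inner_comm]
    exact L2.inner_indicatorConstLp_one hB _ g
  have hΦs : ∀ φ, ∃ g, Φ g = φ := by
    intro φ
    refine ⟨(InnerProductSpace.toDual ℝ _).symm (WeakDual.toStrongDual φ), ?_⟩
    simp [Φ]
  have hgint : ∀ g : Lp ℝ 2 μ, Integrable g μ := fun g =>
    (Lp.memLp g).integrable (by norm_num)
  have hS : ∀ g, Φ g ∈ S ↔ (∀ᵐ x ∂μ, 0 ≤ g x ∧ g x ≤ 1) ∧
      ∀ C ∈ 𝒞, ∫ x in C, g x ∂μ = μ.real C / 2 := by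
    intro g
    constructor
    · rintro ⟨h1, h2⟩
      refine ⟨?_, fun C hC => by rw [← hΦ g C (hm C hC)]; exact h2 C hC⟩
      have a0 : 0 ≤ᵐ[μ] g := ae_nonneg_of_forall_setIntegral_nonneg (hgint g) (fun s hs _ => by
        rw [← hΦ g s hs]; exact (h1 s hs).1)
      have a1 : g ≤ᵐ[μ] fun _ => (1:ℝ) :=
        ae_le_of_forall_setIntegral_le (hgint g) (integrable_const 1) (fun s hs _ => by
          rw [← hΦ g s hs]; simpa using (h1 s hs).2)
      filter_upwards [a0, a1] with x h0 h1 using ⟨h0, h1⟩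
    · rintro ⟨h1, h2⟩
      refine ⟨fun B hB => ?_, fun C hC => by rw [hΦ]; exact h2 C hC⟩
      rw [hΦ]
      refine ⟨integral_nonneg_of_ae (ae_restrict_of_ae (h1.mono fun x hx => hx.1)), ?_⟩
      have := integral_mono_ae (μ := μ.restrict B) (hgint g).integrableOn (integrable_const (1:ℝ))
        (ae_restrict_of_ae (h1.mono fun x hx => hx.2))
      simpa using this
  have hclosed : IsClosed S := by
    have e : S = (⋂ B, ⋂ hB : MeasurableSet B, {φ | 0 ≤ φ (ind B hB)} ∩
        {φ | φ (ind B hB) ≤ μ.real B}) ∩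
        ⋂ C, ⋂ hC : C ∈ 𝒞, {φ | φ (ind C (hm C hC)) = μ.real C / 2} := by
      ext φ; simp [S]
    rw [e]
    refine IsClosed.inter (isClosed_iInter fun B => isClosed_iInter fun hB => IsClosed.inter ?_ ?_)
      (isClosed_iInter fun C => isClosed_iInter fun hC => ?_)
    · exact isClosed_le continuous_const (WeakDual.eval_continuous _)
    · exact isClosed_le (WeakDual.eval_continuous _) continuous_const
    · exact isClosed_eq (WeakDual.eval_continuous _) continuous_const
  have hbdd : Bornology.IsBounded S := by
    rw [← WeakDual.isBounded_toWeakDual_preimage_iff_isBounded, isBounded_iff_forall_norm_le]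
    refine ⟨(measureUnivNNReal μ : ℝ) ^ (2:ℝ)⁻¹, fun φ hφ => ?_⟩
    obtain ⟨g, hg⟩ := hΦs (StrongDual.toWeakDual φ)
    have hgS : Φ g ∈ S := by rw [hg]; exact hφ
    have : φ = InnerProductSpace.toDual ℝ _ g := by
      apply StrongDual.toWeakDual.injective; exact hg.symm
    rw [this, LinearIsometryEquiv.norm_map]
    have := Lp.norm_le_of_ae_bound (f := g) zero_le_one
      (((hS g).1 hgS).1.mono fun x hx => by rw [Real.norm_eq_abs, abs_le]; constructor <;> linarith [hx.1, hx.2])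
    simpa using this
  have hcomp : IsCompact S := WeakDual.isCompact_of_bounded_of_closed hbdd hclosed
  have hne : S.Nonempty := by
    refine ⟨Φ (Lp.const 2 μ (1/2:ℝ)), (hS _).2 ⟨?_, ?_⟩⟩
    · filter_upwards [Lp.coeFn_const (p := 2) (μ := μ) (1/2:ℝ)] with x hx
      rw [hx]; norm_num
    · intro C hC
      rw [integral_congr_ae (ae_restrict_of_ae (Lp.coeFn_const (p := 2) (μ := μ) (1/2:ℝ)))]
      simp [div_eq_mul_inv]
  have : LocallyConvexSpace ℝ (WeakDual ℝ (Lp ℝ 2 μ)) :=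
    inferInstanceAs (LocallyConvexSpace ℝ (WeakBilin (topDualPairing ℝ (Lp ℝ 2 μ))))
  obtain ⟨φ, hφ⟩ := hcomp.extremePoints_nonempty hne
  obtain ⟨g, rfl⟩ := hΦs φ
  rw [mem_extremePoints] at hφ
  obtain ⟨hgS, hext⟩ := hφ
  obtain ⟨hg01, hgC⟩ := (hS g).1 hgS
  have hgm : Measurable g := (Lp.stronglyMeasurable g).measurable
  -- the middle sets are null
  have hmid : ∀ n : ℕ, μ {x | 1 / ((n:ℝ) + 1) ≤ g x ∧ g x ≤ 1 - 1 / ((n:ℝ) + 1)} = 0 := by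
    intro n
    set δ : ℝ := 1 / ((n:ℝ) + 1) with hδ
    have hδpos : 0 < δ := by positivity
    set E : Set K := {x | δ ≤ g x ∧ g x ≤ 1 - δ} with hE
    have hEm : MeasurableSet E :=
      (measurableSet_le measurable_const hgm).inter (measurableSet_le hgm measurable_const)
    by_contra hpos
    obtain ⟨h, hhm, hh1, hhC, hh0⟩ := aux_h (μ.restrict E) (hμ E hEm (pos_iff_ne_zero.2 hpos)) 𝒞 hc hm
    rw [ae_restrict_iff' hEm] at hh1
    let k : K → ℝ := E.indicator (fun x => δ * h x)
    have hk1 : ∀ᵐ x ∂μ, |k x| ≤ δ := by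
      filter_upwards [hh1] with x hx
      by_cases hxE : x ∈ E
      · simp only [k, Set.indicator_of_mem hxE, abs_mul, abs_of_pos hδpos]
        nlinarith [hx hxE]
      · simp [k, Set.indicator_of_notMem hxE, hδpos.le]
    have hkL : MemLp k 2 μ := MemLp.of_bound
      ((hhm.const_mul δ).indicator hEm).aestronglyMeasurable δ hk1
    let H : Lp ℝ 2 μ := hkL.toLp k
    have hHk : H =ᵐ[μ] k := hkL.coeFn_toLp
    have hHC : ∀ C ∈ 𝒞, ∫ x in C, H x ∂μ = 0 := by
      intro C hC
      rw [integral_congr_ae (ae_restrict_of_ae hHk)]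
      simp only [k]
      rw [integral_indicator hEm, Measure.restrict_restrict hEm, Set.inter_comm,
        ← Measure.restrict_restrict (hm C hC), integral_const_mul, hhC C hC, mul_zero]
    have hp : Φ (g + H) ∈ S := by
      rw [hS]
      constructor
      · filter_upwards [Lp.coeFn_add g H, hHk, hk1, hg01] with x h1 h2 h3 h4
        rw [h1, Pi.add_apply, h2]
        by_cases hxE : x ∈ E
        · have := abs_le.1 h3
          exact ⟨by linarith [hxE.1], by linarith [hxE.2]⟩
        · simp only [k, Set.indicator_of_notMem hxE, add_zero]; exact h4
      · intro C hC
        rw [integral_congr_ae (ae_restrict_of_ae (Lp.coeFn_add g H))]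
        simp only [Pi.add_apply]
        rw [integral_add (hgint g).integrableOn (hgint H).integrableOn, hgC C hC, hHC C hC, add_zero]
    have hn : Φ (g - H) ∈ S := by
      rw [hS]
      constructor
      · filter_upwards [Lp.coeFn_sub g H, hHk, hk1, hg01] with x h1 h2 h3 h4
        rw [h1, Pi.sub_apply, h2]
        by_cases hxE : x ∈ E
        · have := abs_le.1 h3
          exact ⟨by linarith [hxE.1], by linarith [hxE.2]⟩
        · simp only [k, Set.indicator_of_notMem hxE, sub_zero]; exact h4
      · intro C hC
        rw [integral_congr_ae (ae_restrict_of_ae (Lp.coeFn_sub g H))]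
        simp only [Pi.sub_apply]
        rw [integral_sub (hgint g).integrableOn (hgint H).integrableOn, hgC C hC, hHC C hC, sub_zero]
    have hseg : Φ g ∈ openSegment ℝ (Φ (g + H)) (Φ (g - H)) := by
      refine ⟨1/2, 1/2, by norm_num, by norm_num, by norm_num, ?_⟩
      simp only [Φ, map_add, map_sub]
      module
    have heq := (hext _ hp _ hn hseg).1
    have hH0 : H = 0 := by
      have : g + H = g := (InnerProductSpace.toDual ℝ _).injective
        (StrongDual.toWeakDual.injective heq)
      simpa using this
    apply hh0
    rw [Filter.EventuallyEq, ae_restrict_iff' hEm]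
    have hz : H =ᵐ[μ] 0 := by rw [hH0]; exact Lp.coeFn_zero _ _ _
    filter_upwards [hz, hHk] with x h1 h2 hxE
    rw [h1] at h2
    simp only [k, Set.indicator_of_mem hxE, Pi.zero_apply] at h2
    simpa [hδpos.ne'] using h2.symm
  have h01 : ∀ᵐ x ∂μ, g x = 0 ∨ g x = 1 := by
    have hall : ∀ᵐ x ∂μ, ∀ n : ℕ, ¬ (1 / ((n:ℝ) + 1) ≤ g x ∧ g x ≤ 1 - 1 / ((n:ℝ) + 1)) := by
      rw [ae_all_iff]; intro n; rw [ae_iff]; simpa only [not_not] using hmid n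
    filter_upwards [hall, hg01] with x hx h01
    by_contra hcon
    push Not at hcon
    have p0 : 0 < g x := lt_of_le_of_ne h01.1 hcon.1.symm
    have p1 : g x < 1 := lt_of_le_of_ne h01.2 hcon.2
    obtain ⟨n, hn⟩ := exists_nat_one_div_lt (lt_min p0 (sub_pos.2 p1))
    exact hx n ⟨(hn.trans_le (min_le_left _ _)).le, by linarith [hn.trans_le (min_le_right _ _)]⟩
  refine ⟨g ⁻¹' {1}, hgm (measurableSet_singleton 1), fun C hC => ?_⟩
  have hB : MeasurableSet (g ⁻¹' {(1:ℝ)}) := hgm (measurableSet_singleton 1)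
  have hgi : g =ᵐ[μ] (g ⁻¹' {(1:ℝ)}).indicator (fun _ => (1:ℝ)) := by
    filter_upwards [h01] with x hx
    rcases hx with hx | hx <;> simp [Set.indicator, hx]
  have := hgC C hC
  rw [integral_congr_ae (ae_restrict_of_ae hgi), integral_indicator hB,
    Measure.restrict_restrict hB] at this
  simp only [integral_const, smul_eq_mul, mul_one, measureReal_restrict_apply_univ] at this
  rw [← ENNReal.toReal_eq_toReal_iff' (measure_ne_top _ _)
    (ENNReal.div_ne_top (measure_ne_top _ _) (by norm_num)), ENNReal.toReal_div]
  simpa [Measure.real] using this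

/-- If `μ` is homogeneous of Maharam type `ω₁` and `𝒞` is a countable family of Borel sets,
then there is a Borel set `B` of measure `1/2` which is `μ`-independent of `𝒞`. -/
theorem stmt7 (K : Type*) [TopologicalSpace K] [CompactSpace K] [T2Space K]
    (μ : RadonProb K) (hμ : IsHomogeneousOmega1 μ.1)
    (𝒞 : Set (Set K)) (h𝒞c : 𝒞.Countable) (h𝒞m : ∀ C ∈ 𝒞, MeasurableSet[borel K] C) :
    ∃ B : Set K, MeasurableSet[borel K] B ∧ μ.1 B = 1/2 ∧
      ∀ C ∈ 𝒞, μ.1 (B ∩ C) = μ.1 C / 2 := by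
  have hP : @IsProbabilityMeasure K (borel K) μ.1 := μ.2.1
  obtain ⟨B, hB, hBC⟩ := @aux_main K (borel K) μ.1 hP hμ.2 (insert Set.univ 𝒞) (h𝒞c.insert _)
    (by
      rintro C (rfl | hC)
      · exact @MeasurableSet.univ K (borel K)
      · exact h𝒞m C hC)
  refine ⟨B, hB, ?_, fun C hC => hBC C (Set.mem_insert_of_mem _ hC)⟩
  have h := hBC Set.univ (Set.mem_insert _ _)
  rw [Set.inter_univ, hP.measure_univ] at h
  exact h
end
end

section
/- Let μ be a Radon probability measure on a compact Hausdorff space K which is homogeneous of Maharam type ω₁. For every ε > 0 there exist transfinite sequences ⟨B_ξ : ξ < ω₁⟩ of Borel subsets of K and ⟨U_ξ : ξ < ω₁⟩ of open subsets of K such that for every ξ < ω₁: (i) μ(B_ξ) = 1/2; (ii) B_ξ ⊆ U_ξ and μ(U_ξ \ B_ξ) < ε; (iii) B_ξ is μ-independent of the algebra of sets generated by 𝒞_ξ = {B_η : η < ξ} ∪ {U_η : η < ξ}, i.e. μ(B_ξ ∩ C) = (1/2)·μ(C) for every C in that algebra. -/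
open MeasureTheory Set

noncomputable section

lemma exists_not_rel {Ω : Type*} [mΩ : MeasurableSpace Ω] (μ : Measure Ω) [IsFiniteMeasure μ]
    (𝒞 : Set (Set Ω)) (hc : 𝒞.Countable) (hm : ∀ C ∈ 𝒞, MeasurableSet C)
    (A : Set Ω) (hA : MeasurableSet A)
    (hAt : maharamType (μ.restrict A) = Cardinal.aleph 1) :
    ∃ B ⊆ A, MeasurableSet B ∧
      ∀ C, MeasurableSet[MeasurableSpace.generateFrom 𝒞] C → μ (symmDiff B (A ∩ C)) ≠ 0 := by
  by_contra hcon
  push Not at hcon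
  have hle : MeasurableSpace.generateFrom 𝒞 ≤ mΩ := MeasurableSpace.generateFrom_le hm
  have hgen : MeasurableSpace.generateFrom 𝒞
      = MeasurableSpace.generateFrom (generateSetAlgebra 𝒞) :=
    generateFrom_generateSetAlgebra_eq.symm
  obtain ⟨hd1, hd2⟩ := @Measure.MeasureDense.of_generateFrom_isSetAlgebra_finite Ω
    (MeasurableSpace.generateFrom 𝒞) ((μ.restrict A).trim hle) (generateSetAlgebra 𝒞) _
    isSetAlgebra_generateSetAlgebra hgen
  have hcount : Cardinal.mk (generateSetAlgebra 𝒞) ≤ Cardinal.aleph0 :=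
    Cardinal.le_aleph0_iff_set_countable.2 (countable_generateSetAlgebra hc)
  have hlt : Cardinal.mk (generateSetAlgebra 𝒞) < maharamType (μ.restrict A) := by
    rw [hAt]; exact hcount.trans_lt Cardinal.aleph0_lt_aleph_one
  refine absurd hlt (not_lt.2 (csInf_le' ⟨generateSetAlgebra 𝒞, rfl,
    fun C hC => hle _ (hd1 C hC), ?_⟩))
  intro B hB ε hε
  obtain ⟨C, hC, hC0⟩ := hcon (B ∩ A) inter_subset_right (hB.inter hA)
  obtain ⟨r, hr0, hr⟩ : ∃ r : ℝ, 0 < r ∧ ENNReal.ofReal r ≤ ε := by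
    rcases eq_or_ne ε ⊤ with h | h
    · exact ⟨1, one_pos, by simp [h]⟩
    · exact ⟨ε.toReal, ENNReal.toReal_pos hε.ne' h, by rw [ENNReal.ofReal_toReal h]⟩
  obtain ⟨T, hT, hTr⟩ := hd2 C hC (measure_ne_top _ _) r hr0
  refine ⟨T, hT, lt_of_lt_of_le (lt_of_le_of_lt ?_ hTr) hr⟩
  have hTm := hd1 T hT
  rw [trim_measurableSet_eq hle (hC.symmDiff hTm)]
  have hBC : (μ.restrict A) (symmDiff B C) = 0 := by
    rw [Measure.restrict_apply (hB.symmDiff (hle _ hC))]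
    rw [← hC0]
    congr 1
    ext x
    simp only [mem_inter_iff, mem_symmDiff]
    tauto
  calc (μ.restrict A) (symmDiff B T)
      ≤ (μ.restrict A) (symmDiff B C) + (μ.restrict A) (symmDiff C T) :=
        measure_symmDiff_le _ _ _
    _ = _ := by rw [hBC, zero_add]

lemma exists_perturb {Ω : Type*} (m0 : MeasurableSpace Ω) [mΩ : MeasurableSpace Ω]
    (μ : Measure Ω) [IsProbabilityMeasure μ] (hle : m0 ≤ mΩ)
    (A B : Set Ω) (hA : MeasurableSet A) (hB : MeasurableSet B) (hBA : B ⊆ A)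
    (hne : ∀ C, MeasurableSet[m0] C → μ (symmDiff B (A ∩ C)) ≠ 0) :
    ∃ g : Ω → ℝ, StronglyMeasurable g ∧ (∀ᵐ x ∂μ, |g x| ≤ 1) ∧ (∀ x ∉ A, g x = 0) ∧
      ¬ (g =ᵐ[μ] 0) ∧ ∀ C, MeasurableSet[m0] C → ∫ x in C, g x ∂μ = 0 := by
  set iA : Ω → ℝ := A.indicator (fun _ => (1 : ℝ)) with hiA
  set iB : Ω → ℝ := B.indicator (fun _ => (1 : ℝ)) with hiB
  have hIA : Integrable iA μ := (integrable_const (1 : ℝ)).indicator hA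
  have hIB : Integrable iB μ := (integrable_const (1 : ℝ)).indicator hB
  set a := μ[iA | m0] with ha
  set b := μ[iB | m0] with hb
  have ham : StronglyMeasurable[m0] a := stronglyMeasurable_condExp
  have hbm : StronglyMeasurable[m0] b := stronglyMeasurable_condExp
  have hiA0 : ∀ x, 0 ≤ iA x ∧ iA x ≤ 1 := fun x => by
    by_cases h : x ∈ A <;> simp [hiA, h]
  have hiB0 : ∀ x, 0 ≤ iB x ∧ iB x ≤ 1 := fun x => by
    by_cases h : x ∈ B <;> simp [hiB, h]
  have h1 : μ[(fun _ => (1 : ℝ)) | m0] = fun _ => (1 : ℝ) := condExp_const hle 1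
  have ha0 : 0 ≤ᵐ[μ] a := condExp_nonneg (ae_of_all _ fun x => (hiA0 x).1)
  have hb0 : 0 ≤ᵐ[μ] b := condExp_nonneg (ae_of_all _ fun x => (hiB0 x).1)
  have ha1 : a ≤ᵐ[μ] fun _ => (1 : ℝ) := by
    rw [← h1]; exact condExp_mono hIA (integrable_const _) (ae_of_all _ fun x => (hiA0 x).2)
  have hb1 : b ≤ᵐ[μ] fun _ => (1 : ℝ) := by
    rw [← h1]; exact condExp_mono hIB (integrable_const _) (ae_of_all _ fun x => (hiB0 x).2)
  have hIaB : Integrable (a * iB) μ := by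
    refine Integrable.of_bound ((ham.mono hle).aestronglyMeasurable.mul hIB.1) 1 ?_
    filter_upwards [ha0, ha1] with x h0 h1
    have := hiB0 x
    simp only [Pi.zero_apply, Pi.mul_apply, Real.norm_eq_abs] at *
    rw [abs_of_nonneg (by nlinarith)]; nlinarith
  have hIbA : Integrable (b * iA) μ := by
    refine Integrable.of_bound ((hbm.mono hle).aestronglyMeasurable.mul hIA.1) 1 ?_
    filter_upwards [hb0, hb1] with x h0 h1
    have := hiA0 x
    simp only [Pi.zero_apply, Pi.mul_apply, Real.norm_eq_abs] at *
    rw [abs_of_nonneg (by nlinarith)]; nlinarith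
  have e1 : μ[a * iB | m0] =ᵐ[μ] a * b := condExp_mul_of_stronglyMeasurable_left ham hIaB hIB
  have e2 : μ[b * iA | m0] =ᵐ[μ] b * a := condExp_mul_of_stronglyMeasurable_left hbm hIbA hIA
  refine ⟨a * iB - b * iA, ?_, ?_, ?_, ?_, ?_⟩
  · exact ((ham.mono hle).mul (stronglyMeasurable_const.indicator hB)).sub
      ((hbm.mono hle).mul (stronglyMeasurable_const.indicator hA))
  · filter_upwards [ha0, ha1, hb0, hb1] with x h0 h1 h2 h3
    have := hiA0 x
    have := hiB0 x
    simp only [Pi.zero_apply, Pi.mul_apply, Pi.sub_apply] at *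
    rw [abs_le]; constructor <;> nlinarith
  · intro x hx
    have hxB : x ∉ B := fun h => hx (hBA h)
    simp [hiA, hiB, hx, hxB]
  · intro hg
    -- the set where `b` is positive would cut out `B` from `A`
    apply hne {x | 0 < b x} (hbm.measurable measurableSet_Ioi)
    have hpos : ∀ᵐ x ∂μ, x ∈ A → 0 < a x := by
      have hZ : MeasurableSet[m0] {x | a x ≤ 0} :=
        ham.measurable measurableSet_Iic
      have hz : ∫ x in {x | a x ≤ 0}, iA x ∂μ ≤ 0 := by
        rw [← setIntegral_condExp hle hIA hZ]
        exact setIntegral_nonpos (hle _ hZ) (fun x hx => hx)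
      rw [hiA, setIntegral_indicator hA] at hz
      simp only [integral_const, smul_eq_mul, mul_one] at hz
      have : μ ({x | a x ≤ 0} ∩ A) = 0 := by
        have h2 := le_antisymm hz measureReal_nonneg
        simpa [Measure.real, ENNReal.toReal_eq_zero_iff] using h2
      have h3 : ∀ᵐ x ∂μ, x ∉ {x | a x ≤ 0} ∩ A := measure_eq_zero_iff_ae_notMem.1 this
      filter_upwards [h3] with x hx hxA
      by_contra h
      exact hx ⟨not_lt.1 h, hxA⟩
    rw [measure_eq_zero_iff_ae_notMem]
    filter_upwards [hg, hpos, hb0] with x hx hp hbx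
    simp only [Pi.sub_apply, Pi.mul_apply, Pi.zero_apply] at hx hbx
    rw [mem_symmDiff]
    by_cases hxA : x ∈ A
    · have := hp hxA
      by_cases hxB : x ∈ B
      · simp [hiA, hiB, hxA, hxB] at hx
        simp [hxA, hxB]; linarith
      · simp [hiA, hiB, hxA, hxB] at hx
        simp [hxA, hxB, hx]
    · have hxB : x ∉ B := fun h => hxA (hBA h)
      simp [hxA, hxB]
  · intro C hC
    have : ∫ x in C, (a * iB - b * iA) x ∂μ
        = ∫ x in C, (a * iB) x ∂μ - ∫ x in C, (b * iA) x ∂μ :=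
      integral_sub hIaB.integrableOn hIbA.integrableOn
    rw [this, ← setIntegral_condExp hle hIaB hC, ← setIntegral_condExp hle hIbA hC, sub_eq_zero]
    apply setIntegral_congr_ae (hle _ hC)
    filter_upwards [e1, e2] with x h1 h2 _
    rw [h1, h2]; simp [mul_comm]

lemma exists_half {Ω : Type*} [mΩ : MeasurableSpace Ω] (μ : Measure Ω) [IsProbabilityMeasure μ]
    (hμ : ∀ B : Set Ω, MeasurableSet B → 0 < μ B →
      maharamType (μ.restrict B) = Cardinal.aleph 1)
    (𝒞 : Set (Set Ω)) (hc : 𝒞.Countable) (hm : ∀ C ∈ 𝒞, MeasurableSet C) :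
    ∃ B, MeasurableSet B ∧
      ∀ C, MeasurableSet[MeasurableSpace.generateFrom 𝒞] C → μ (B ∩ C) = μ C / 2 := by
  have hle : MeasurableSpace.generateFrom 𝒞 ≤ mΩ := MeasurableSpace.generateFrom_le hm
  let ind : ∀ E : Set Ω, MeasurableSet E → Lp ℝ 2 μ :=
    fun E hE => indicatorConstLp 2 hE (measure_ne_top μ E) (1 : ℝ)
  let S : Set (WeakDual ℝ (Lp ℝ 2 μ)) :=
    (WeakDual.toStrongDual ⁻¹' Metric.closedBall 0 1) ∩
      {φ | ∀ (E : Set Ω) (hE : MeasurableSet E), 0 ≤ φ (ind E hE) ∧ φ (ind E hE) ≤ μ.real E ∧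
        (MeasurableSet[MeasurableSpace.generateFrom 𝒞] E → φ (ind E hE) = μ.real E / 2)}
  let T : Lp ℝ 2 μ → WeakDual ℝ (Lp ℝ 2 μ) :=
    fun f => StrongDual.toWeakDual (InnerProductSpace.toDual ℝ (Lp ℝ 2 μ) f)
  have hT : ∀ f E (hE : MeasurableSet E), T f (ind E hE) = ∫ x in E, f x ∂μ := by
    intro f E hE
    have : T f (ind E hE) = inner ℝ f (ind E hE) := rfl
    rw [this, real_inner_comm]
    exact L2.inner_indicatorConstLp_one hE _ f
  have hint : ∀ f : Lp ℝ 2 μ, Integrable f μ := fun f =>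
    (Lp.memLp f).integrable (by norm_num)
  have hmem : ∀ f : Lp ℝ 2 μ, (∀ᵐ x ∂μ, 0 ≤ f x) → (∀ᵐ x ∂μ, f x ≤ 1) →
      (∀ C, MeasurableSet[MeasurableSpace.generateFrom 𝒞] C → ∫ x in C, f x ∂μ = μ.real C / 2) → T f ∈ S := by
    intro f h0 h1 hC
    refine ⟨?_, ?_⟩
    · have hn : ‖f‖ ≤ 1 := by
        have := Lp.norm_le_of_ae_bound (f := f) (C := 1) zero_le_one (by
          filter_upwards [h0, h1] with x hx hx1
          rw [Real.norm_eq_abs, abs_of_nonneg hx]; exact hx1)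
        have hu : measureUnivNNReal μ = 1 := by simp [measureUnivNNReal]
        simpa [hu] using this
      simp only [mem_preimage, mem_closedBall_zero_iff]
      change ‖InnerProductSpace.toDual ℝ (Lp ℝ 2 μ) f‖ ≤ 1
      simpa using hn
    · intro E hE
      rw [hT]
      refine ⟨setIntegral_nonneg_of_ae h0, ?_, hC E⟩
      have := setIntegral_mono_ae (s := E) (hint f).integrableOn
        (integrable_const (1 : ℝ)).integrableOn h1
      simpa using this
  have hScomp : IsCompact S := by
    refine (WeakDual.isCompact_closedBall 0 1).inter_right ?_
    have hev : ∀ v : Lp ℝ 2 μ, Continuous fun φ : WeakDual ℝ (Lp ℝ 2 μ) => φ v :=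
      fun v => WeakDual.eval_continuous v
    simp only [setOf_forall, setOf_and]
    refine isClosed_iInter fun E => isClosed_iInter fun hE => ?_
    refine (isClosed_le continuous_const (hev _)).inter
      ((isClosed_le (hev _) continuous_const).inter ?_)
    exact isClosed_iInter fun _ => isClosed_eq (hev _) continuous_const
  have hSne : S.Nonempty := by
    have hM : MemLp (fun _ : Ω => (1 / 2 : ℝ)) 2 μ := memLp_const _
    refine ⟨T (hM.toLp _), hmem _ ?_ ?_ ?_⟩
    · filter_upwards [hM.coeFn_toLp] with x hx
      rw [hx]; norm_num
    · filter_upwards [hM.coeFn_toLp] with x hx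
      rw [hx]; norm_num
    · intro C hC
      rw [setIntegral_congr_ae (g := fun _ => (1 / 2 : ℝ)) (hle _ hC)
        (by filter_upwards [hM.coeFn_toLp] with x hx _ using hx)]
      simp; ring
  have : LocallyConvexSpace ℝ (WeakDual ℝ (Lp ℝ 2 μ)) :=
    WeakBilin.locallyConvexSpace
  obtain ⟨φ, hφ⟩ := hScomp.extremePoints_nonempty hSne
  obtain ⟨f, rfl⟩ : ∃ f, T f = φ :=
    ⟨(InnerProductSpace.toDual ℝ (Lp ℝ 2 μ)).symm (WeakDual.toStrongDual φ), by simp [T]⟩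
  have hfS : T f ∈ S := hφ.1
  have hf2 := hfS.2
  simp only [mem_setOf_eq, hT] at hf2
  have hf0 : ∀ᵐ x ∂μ, 0 ≤ f x :=
    ae_nonneg_of_forall_setIntegral_nonneg (hint f) fun s hs _ => (hf2 s hs).1
  have hf1 : ∀ᵐ x ∂μ, f x ≤ 1 :=
    ae_le_of_forall_setIntegral_le (hint f) (integrable_const (1 : ℝ)) fun s hs _ => by
      simpa using (hf2 s hs).2.1
  have hfm : Measurable f := (Lp.stronglyMeasurable f).measurable
  have hA0 : ∀ n : ℕ, μ {x | 1 / ((n : ℝ) + 1) < f x ∧ f x < 1 - 1 / ((n : ℝ) + 1)} = 0 := by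
    intro n
    by_contra hne
    set δ : ℝ := 1 / ((n : ℝ) + 1) with hδ
    have hδ0 : 0 < δ := by positivity
    set A := {x | δ < f x ∧ f x < 1 - δ} with hAdef
    have hAm : MeasurableSet A :=
      (measurableSet_lt measurable_const hfm).inter (measurableSet_lt hfm measurable_const)
    obtain ⟨B, hBA, hBm, hB⟩ := exists_not_rel μ 𝒞 hc hm A hAm (hμ A hAm (pos_iff_ne_zero.2 hne))
    obtain ⟨g, hgm, hg1, hgA, hg0, hgC⟩ := exists_perturb _ μ hle A B hAm hBm hBA hB
    have hMg : MemLp (fun x => δ * g x) 2 μ := by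
      refine MemLp.of_bound (hgm.const_mul δ).aestronglyMeasurable δ ?_
      filter_upwards [hg1] with x hx
      rw [Real.norm_eq_abs, abs_mul, abs_of_pos hδ0]
      nlinarith
    set G := hMg.toLp _ with hG
    have hGx : ∀ᵐ x ∂μ, G x = δ * g x := hMg.coeFn_toLp
    have hGC : ∀ C, MeasurableSet[MeasurableSpace.generateFrom 𝒞] C → ∫ x in C, G x ∂μ = 0 := by
      intro C hC
      rw [setIntegral_congr_ae (g := fun x => δ * g x) (hle _ hC)
        (by filter_upwards [hGx] with x hx _ using hx), integral_const_mul, hgC C hC, mul_zero]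
    have hplus : T (f + G) ∈ S := by
      refine hmem _ ?_ ?_ ?_
      · filter_upwards [Lp.coeFn_add f G, hGx, hg1, hf0] with x h1 h2 h3 h4
        rw [h1, Pi.add_apply, h2]
        by_cases hx : x ∈ A
        · have := hx.1; have := (abs_le.1 h3).1; nlinarith
        · rw [hgA x hx]; linarith
      · filter_upwards [Lp.coeFn_add f G, hGx, hg1, hf1] with x h1 h2 h3 h4
        rw [h1, Pi.add_apply, h2]
        by_cases hx : x ∈ A
        · have := hx.2; have := (abs_le.1 h3).2; nlinarith
        · rw [hgA x hx]; linarith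
      · intro C hC
        rw [setIntegral_congr_ae (g := fun x => f x + G x) (hle _ hC)
          (by filter_upwards [Lp.coeFn_add f G] with x hx _ using hx),
          integral_add (hint f).integrableOn (hint G).integrableOn, hGC C hC, add_zero]
        exact (hf2 C (hle _ hC)).2.2 hC
    have hminus : T (f - G) ∈ S := by
      refine hmem _ ?_ ?_ ?_
      · filter_upwards [Lp.coeFn_sub f G, hGx, hg1, hf0] with x h1 h2 h3 h4
        rw [h1, Pi.sub_apply, h2]
        by_cases hx : x ∈ A
        · have := hx.1; have := (abs_le.1 h3).2; nlinarith
        · rw [hgA x hx]; linarith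
      · filter_upwards [Lp.coeFn_sub f G, hGx, hg1, hf1] with x h1 h2 h3 h4
        rw [h1, Pi.sub_apply, h2]
        by_cases hx : x ∈ A
        · have := hx.2; have := (abs_le.1 h3).1; nlinarith
        · rw [hgA x hx]; linarith
      · intro C hC
        rw [setIntegral_congr_ae (g := fun x => f x - G x) (hle _ hC)
          (by filter_upwards [Lp.coeFn_sub f G] with x hx _ using hx),
          integral_sub (hint f).integrableOn (hint G).integrableOn, hGC C hC, sub_zero]
        exact (hf2 C (hle _ hC)).2.2 hC
    have hseg : T f ∈ openSegment ℝ (T (f + G)) (T (f - G)) := by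
      refine ⟨1 / 2, 1 / 2, by norm_num, by norm_num, by norm_num, ?_⟩
      simp only [T, map_add, map_sub]
      module
    have heq : T (f + G) = T f := hφ.2 hplus hminus hseg
    have hGz : G = 0 := by
      have : f + G = f := by
        apply (InnerProductSpace.toDual ℝ (Lp ℝ 2 μ)).injective
        exact StrongDual.toWeakDual.injective heq
      simpa using this
    apply hg0
    have hz : ∀ᵐ x ∂μ, G x = 0 := by
      rw [hGz]; exact Lp.coeFn_zero ℝ 2 μ
    filter_upwards [hGx, hz] with x h1 h2
    rw [h2] at h1
    have := mul_eq_zero.1 h1.symm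
    simpa [hδ0.ne'] using this
  have hfin : ∀ᵐ x ∂μ, f x = 0 ∨ f x = 1 := by
    have h : ∀ᵐ x ∂μ, ∀ n : ℕ,
        x ∉ {x | 1 / ((n : ℝ) + 1) < f x ∧ f x < 1 - 1 / ((n : ℝ) + 1)} :=
      ae_all_iff.2 fun n => measure_eq_zero_iff_ae_notMem.1 (hA0 n)
    filter_upwards [h, hf0, hf1] with x hx h0 h1
    by_contra hcon
    push Not at hcon
    have h0' : 0 < f x := lt_of_le_of_ne h0 (Ne.symm hcon.1)
    have h1' : 0 < 1 - f x := sub_pos.2 (lt_of_le_of_ne h1 hcon.2)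
    obtain ⟨n, hn⟩ := exists_nat_one_div_lt (lt_min h0' h1')
    exact hx n ⟨hn.trans_le (min_le_left _ _), by
      have := hn.trans_le (min_le_right _ _); linarith⟩
  have hBm : MeasurableSet (f ⁻¹' {1}) := hfm (measurableSet_singleton 1)
  refine ⟨f ⁻¹' {1}, hBm, fun C hC => ?_⟩
  have h1 : ∫ x in C, f x ∂μ = μ.real (f ⁻¹' {1} ∩ C) := by
    rw [setIntegral_congr_ae (g := (f ⁻¹' {1}).indicator fun _ => (1 : ℝ)) (hle _ hC) (by
      filter_upwards [hfin] with x hx _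
      by_cases h : f x = 1
      · simp [h]
      · simp [indicator, h, hx.resolve_right h]), setIntegral_indicator hBm]
    simp [inter_comm]
  rw [(hf2 C (hle _ hC)).2.2 hC] at h1
  rw [← ENNReal.toReal_eq_toReal_iff' (measure_ne_top _ _)
    (ENNReal.div_ne_top (measure_ne_top _ _) (by norm_num)), ENNReal.toReal_div]
  simpa [Measure.real] using h1.symm

lemma exists_step (K : Type*) [TopologicalSpace K] [CompactSpace K] [T2Space K]
    (μ : RadonProb K) (hμ : IsHomogeneousOmega1 μ.1) (ε : ℝ) (hε : 0 < ε)
    (𝒞 : Set (Set K)) (hc : 𝒞.Countable) (hm : ∀ C ∈ 𝒞, MeasurableSet[borel K] C) :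
    ∃ p : Set K × Set K, MeasurableSet[borel K] p.1 ∧ IsOpen p.2 ∧
      μ.1 p.1 = 1/2 ∧ p.1 ⊆ p.2 ∧ μ.1 (p.2 \ p.1) < ENNReal.ofReal ε ∧
      ∀ C ∈ MeasureTheory.generateSetAlgebra 𝒞, μ.1 (p.1 ∩ C) = μ.1 C / 2 := by
  let : MeasurableSpace K := borel K
  have : BorelSpace K := ⟨rfl⟩
  have := μ.2.1
  have := μ.2.2
  obtain ⟨B, hB, hBC⟩ := exists_half μ.1 hμ.2 𝒞 hc hm
  obtain ⟨F, hFB, hF, hFε⟩ := hB.compl.exists_isCompact_sdiff_lt (μ := μ.1)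
    (measure_ne_top _ _) (ENNReal.ofReal_pos.2 hε).ne'
  refine ⟨(B, Fᶜ), hB, hF.isClosed.isOpen_compl, ?_, ?_, ?_, ?_⟩
  · have := hBC univ MeasurableSet.univ
    simpa using this
  · exact subset_compl_comm.1 hFB
  · have : Fᶜ \ B = Bᶜ \ F := by ext x; simp [and_comm]
    simpa only [this] using hFε
  · intro C hC
    refine hBC C ?_
    rw [← generateFrom_generateSetAlgebra_eq]
    exact MeasurableSpace.measurableSet_generateFrom hC

/-- For `μ` homogeneous of Maharam type `ω₁` and `ε > 0` there are transfinite sequences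
`⟨B_ξ : ξ < ω₁⟩` of Borel sets and `⟨U_ξ : ξ < ω₁⟩` of open sets with `μ(B_ξ) = 1/2`,
`B_ξ ⊆ U_ξ`, `μ(U_ξ \ B_ξ) < ε`, and `B_ξ` `μ`-independent of the algebra generated by
`{B_η : η < ξ} ∪ {U_η : η < ξ}`. -/
theorem stmt8 (K : Type*) [TopologicalSpace K] [CompactSpace K] [T2Space K]
    (μ : RadonProb K) (hμ : IsHomogeneousOmega1 μ.1) (ε : ℝ) (hε : 0 < ε) :
    ∃ B U : Ordinal → Set K, ∀ ξ < (Cardinal.aleph 1).ord,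
      MeasurableSet[borel K] (B ξ) ∧ IsOpen (U ξ) ∧
      μ.1 (B ξ) = 1/2 ∧ B ξ ⊆ U ξ ∧ μ.1 (U ξ \ B ξ) < ENNReal.ofReal ε ∧
      ∀ C ∈ MeasureTheory.generateSetAlgebra
          ({S | ∃ η < ξ, S = B η} ∪ {S | ∃ η < ξ, S = U η} : Set (Set K)),
        μ.1 (B ξ ∩ C) = μ.1 C / 2 := by
  classical
  let Good : Set (Set K) → Set K × Set K → Prop := fun 𝒞 p =>
    MeasurableSet[borel K] p.1 ∧ IsOpen p.2 ∧
      μ.1 p.1 = 1/2 ∧ p.1 ⊆ p.2 ∧ μ.1 (p.2 \ p.1) < ENNReal.ofReal ε ∧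
      ∀ C ∈ MeasureTheory.generateSetAlgebra 𝒞, μ.1 (p.1 ∩ C) = μ.1 C / 2
  let G : Set (Set K) → Set K × Set K := fun 𝒞 =>
    if h : ∃ p, Good 𝒞 p then h.choose else (∅, ∅)
  have hG : ∀ 𝒞, (∃ p, Good 𝒞 p) → Good 𝒞 (G 𝒞) := by
    intro 𝒞 h
    simp only [G, dif_pos h]
    exact h.choose_spec
  let step : (ξ : Ordinal) → ((η : Ordinal) → η < ξ → Set K × Set K) → Set K × Set K :=
    fun ξ F => G ({S | ∃ (η : Ordinal) (h : η < ξ), S = (F η h).1} ∪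
      {S | ∃ (η : Ordinal) (h : η < ξ), S = (F η h).2})
  let F : Ordinal → Set K × Set K := Ordinal.lt_wf.fix step
  have hF : ∀ ξ, F ξ = G ({S | ∃ η < ξ, S = (F η).1} ∪ {S | ∃ η < ξ, S = (F η).2}) := by
    intro ξ
    have := Ordinal.lt_wf.fix_eq step ξ
    simp only [step, exists_prop] at this
    exact this
  refine ⟨fun ξ => (F ξ).1, fun ξ => (F ξ).2, ?_⟩
  intro ξ
  induction ξ using WellFoundedLT.induction with
  | _ ξ ih =>
    intro hξ
    have hcount : (Set.Iio ξ).Countable := by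
      rw [← Cardinal.le_aleph0_iff_set_countable, Cardinal.mk_Iio_ordinal,
        Cardinal.lift_le_aleph0, ← Cardinal.lt_aleph_one_iff]
      exact Cardinal.lt_ord.1 hξ
    have key : Good ({S | ∃ η < ξ, S = (F η).1} ∪ {S | ∃ η < ξ, S = (F η).2}) (F ξ) := by
      rw [hF ξ]
      refine hG _ (exists_step K μ hμ ε hε _ ?_ ?_)
      · refine Set.Countable.union ((hcount.image fun η => (F η).1).mono ?_)
          ((hcount.image fun η => (F η).2).mono ?_)
        · rintro S ⟨η, h, rfl⟩; exact ⟨η, h, rfl⟩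
        · rintro S ⟨η, h, rfl⟩; exact ⟨η, h, rfl⟩
      · rintro C (⟨η, h, rfl⟩ | ⟨η, h, rfl⟩)
        · exact (ih η h (h.trans hξ)).1
        · exact MeasurableSpace.measurableSet_generateFrom (ih η h (h.trans hξ)).2.1
    exact key
end
end

section
/- Let K be a compact Hausdorff space, μ a Radon probability measure on K, and let 𝓡 = Bor(K) ⊗ Bor(K) be the algebra of subsets of K×K generated by all rectangles B×C with B, C Borel in K. Then every finitely additive probability measure ν on 𝓡 whose marginals are μ (that is, ν(B×K) = ν(K×B) = μ(B) for every Borel B ⊆ K) extends to a Radon (regular Borel) probability measure on K×K. -/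
open MeasureTheory Set

noncomputable section

section Aux

variable {X : Type*} {𝒜 : Set (Set X)} {ν : Set X → ℝ}

theorem IsFinAddProb.mono' (hA : IsSetAlgebra 𝒜) (hν : IsFinAddProb 𝒜 ν) {S T : Set X}
    (hS : S ∈ 𝒜) (hT : T ∈ 𝒜) (h : S ⊆ T) : ν S ≤ ν T := by
  have h1 := hν.2.2 S hS (T \ S) (hA.sdiff_mem hT hS) disjoint_sdiff_self_right
  rw [Set.union_sdiff_cancel h] at h1
  have := hν.1 _ (hA.sdiff_mem hT hS)
  linarith

theorem IsFinAddProb.diff_add (hA : IsSetAlgebra 𝒜) (hν : IsFinAddProb 𝒜 ν) {S T : Set X}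
    (hS : S ∈ 𝒜) (hT : T ∈ 𝒜) (h : S ⊆ T) : ν T = ν S + ν (T \ S) := by
  have h1 := hν.2.2 S hS (T \ S) (hA.sdiff_mem hT hS) disjoint_sdiff_self_right
  rwa [Set.union_sdiff_cancel h] at h1

theorem IsFinAddProb.union_le (hA : IsSetAlgebra 𝒜) (hν : IsFinAddProb 𝒜 ν) {S T : Set X}
    (hS : S ∈ 𝒜) (hT : T ∈ 𝒜) : ν (S ∪ T) ≤ ν S + ν T := by
  have h1 := hν.2.2 S hS (T \ S) (hA.sdiff_mem hT hS) disjoint_sdiff_self_right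
  rw [Set.union_sdiff_self] at h1
  have := hν.mono' hA (hA.sdiff_mem hT hS) hT sdiff_subset
  linarith

variable [TopologicalSpace X]

/-- Values of `ν` on open members of the algebra containing `C`. -/
def outerVals (𝒜 : Set (Set X)) (ν : Set X → ℝ) (C : Set X) : Set ℝ :=
  {r | ∃ V ∈ 𝒜, IsOpen V ∧ C ⊆ V ∧ ν V = r}

theorem outerVals_bdd (hν : IsFinAddProb 𝒜 ν) (C : Set X) : BddBelow (outerVals 𝒜 ν C) :=
  ⟨0, by rintro r ⟨V, hV, -, -, rfl⟩; exact hν.1 V hV⟩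

theorem outerVals_nonempty (hA : IsSetAlgebra 𝒜) (C : Set X) : (outerVals 𝒜 ν C).Nonempty :=
  ⟨_, univ, hA.univ_mem, isOpen_univ, subset_univ _, rfl⟩

theorem outerVals_exists (hA : IsSetAlgebra 𝒜) (C : Set X) {ε : ℝ} (hε : 0 < ε) :
    ∃ V ∈ 𝒜, IsOpen V ∧ C ⊆ V ∧ ν V < sInf (outerVals 𝒜 ν C) + ε := by
  obtain ⟨r, ⟨V, h1, h2, h3, rfl⟩, h⟩ :=
    exists_lt_of_csInf_lt (outerVals_nonempty (ν := ν) hA C) (lt_add_of_pos_right _ hε)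
  exact ⟨V, h1, h2, h3, h⟩

theorem outerVals_nonneg (hν : IsFinAddProb 𝒜 ν) (C : Set X) : 0 ≤ sInf (outerVals 𝒜 ν C) :=
  Real.sInf_nonneg (by rintro r ⟨V, hV, -, -, rfl⟩; exact hν.1 V hV)

/-- The content attached to `ν`. -/
def finAddContent [T2Space X] (hA : IsSetAlgebra 𝒜) (hν : IsFinAddProb 𝒜 ν)
    (hsep : ∀ C U : Set X, IsCompact C → IsOpen U → C ⊆ U → ∃ V ∈ 𝒜, IsOpen V ∧ C ⊆ V ∧ V ⊆ U) :
    Content X where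
  toFun C := Real.toNNReal (sInf (outerVals 𝒜 ν C))
  mono' C D h := by
    refine Real.toNNReal_le_toNNReal ?_
    refine csInf_le_csInf (outerVals_bdd hν _) (outerVals_nonempty hA _) ?_
    rintro r ⟨V, h1, h2, h3, h4⟩
    exact ⟨V, h1, h2, h.trans h3, h4⟩
  sup_le' C D := by
    rw [← Real.toNNReal_add (outerVals_nonneg hν _) (outerVals_nonneg hν _)]
    refine Real.toNNReal_le_toNNReal ?_
    refine le_of_forall_pos_le_add fun ε hε => ?_
    obtain ⟨V, h1, h2, h3, h4⟩ := outerVals_exists (ν := ν) hA (C : Set X) (half_pos hε)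
    obtain ⟨W, k1, k2, k3, k4⟩ := outerVals_exists (ν := ν) hA (D : Set X) (half_pos hε)
    have h5 := hν.union_le hA h1 k1
    have h6 : sInf (outerVals 𝒜 ν ((C ⊔ D : TopologicalSpace.Compacts X) : Set X)) ≤ ν (V ∪ W) := by
      refine csInf_le (outerVals_bdd hν _) ⟨V ∪ W, hA.union_mem h1 k1, h2.union k2, ?_, rfl⟩
      rw [TopologicalSpace.Compacts.coe_sup]
      exact union_subset_union h3 k3
    linarith
  sup_disjoint' C D hd _ hDc := by
    refine le_antisymm ?_ ?_
    · rw [← Real.toNNReal_add (outerVals_nonneg hν _) (outerVals_nonneg hν _)]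
      refine Real.toNNReal_le_toNNReal ?_
      refine le_of_forall_pos_le_add fun ε hε => ?_
      obtain ⟨V, h1, h2, h3, h4⟩ := outerVals_exists (ν := ν) hA (C : Set X) (half_pos hε)
      obtain ⟨W, k1, k2, k3, k4⟩ := outerVals_exists (ν := ν) hA (D : Set X) (half_pos hε)
      have h5 := hν.union_le hA h1 k1
      have h6 : sInf (outerVals 𝒜 ν ((C ⊔ D : TopologicalSpace.Compacts X) : Set X)) ≤ ν (V ∪ W) := by
        refine csInf_le (outerVals_bdd hν _) ⟨V ∪ W, hA.union_mem h1 k1, h2.union k2, ?_, rfl⟩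
        rw [TopologicalSpace.Compacts.coe_sup]
        exact union_subset_union h3 k3
      linarith
    · rw [← Real.toNNReal_add (outerVals_nonneg hν _) (outerVals_nonneg hν _)]
      refine Real.toNNReal_le_toNNReal ?_
      obtain ⟨U, U', hU, hU', hCU, hDU', hUU⟩ :=
        SeparatedNhds.of_isCompact_isCompact C.isCompact D.isCompact hd
      obtain ⟨V, v1, v2, v3, v4⟩ := hsep _ U C.isCompact hU hCU
      obtain ⟨W, w1, w2, w3, w4⟩ := hsep _ U' D.isCompact hU' hDU'
      refine le_csInf (outerVals_nonempty hA _) ?_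
      rintro r ⟨S, s1, s2, s3, rfl⟩
      rw [TopologicalSpace.Compacts.coe_sup] at s3
      have h1 : sInf (outerVals 𝒜 ν (C : Set X)) ≤ ν (S ∩ V) :=
        csInf_le (outerVals_bdd hν _) ⟨_, hA.inter_mem s1 v1, s2.inter v2,
          subset_inter (subset_union_left.trans s3) v3, rfl⟩
      have h2 : sInf (outerVals 𝒜 ν (D : Set X)) ≤ ν (S ∩ W) :=
        csInf_le (outerVals_bdd hν _) ⟨_, hA.inter_mem s1 w1, s2.inter w2,
          subset_inter (subset_union_right.trans s3) w3, rfl⟩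
      have h3 := hν.2.2 _ (hA.inter_mem s1 v1) _ (hA.inter_mem s1 w1)
        (hUU.mono (inter_subset_right.trans v4) (inter_subset_right.trans w4))
      have h4 := hν.mono' hA (hA.union_mem (hA.inter_mem s1 v1) (hA.inter_mem s1 w1)) s1
        (union_subset inter_subset_left inter_subset_left)
      linarith

/-- `S` is approximable from inside by compact members of the algebra. -/
def InnerApprox (𝒜 : Set (Set X)) (ν : Set X → ℝ) (S : Set X) : Prop :=
  ∀ ε : ℝ, 0 < ε → ∃ L ∈ 𝒜, IsCompact L ∧ L ⊆ S ∧ ν (S \ L) < ε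

theorem InnerApprox.union (hA : IsSetAlgebra 𝒜) (hν : IsFinAddProb 𝒜 ν) {S T : Set X}
    (hS : S ∈ 𝒜) (hT : T ∈ 𝒜) (h1 : InnerApprox 𝒜 ν S) (h2 : InnerApprox 𝒜 ν T) :
    InnerApprox 𝒜 ν (S ∪ T) := by
  intro ε hε
  obtain ⟨L, l1, l2, l3, l4⟩ := h1 _ (half_pos hε)
  obtain ⟨M, m1, m2, m3, m4⟩ := h2 _ (half_pos hε)
  refine ⟨L ∪ M, hA.union_mem l1 m1, l2.union m2, union_subset_union l3 m3, ?_⟩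
  have a := hν.mono' hA (hA.sdiff_mem (hA.union_mem hS hT) (hA.union_mem l1 m1))
    (hA.union_mem (hA.sdiff_mem hS l1) (hA.sdiff_mem hT m1))
    (by intro x hx; simp only [Set.mem_sdiff, mem_union] at hx ⊢; tauto)
  have b := hν.union_le hA (hA.sdiff_mem hS l1) (hA.sdiff_mem hT m1)
  linarith

theorem InnerApprox.inter [T2Space X] (hA : IsSetAlgebra 𝒜) (hν : IsFinAddProb 𝒜 ν) {S T : Set X}
    (hS : S ∈ 𝒜) (hT : T ∈ 𝒜) (h1 : InnerApprox 𝒜 ν S) (h2 : InnerApprox 𝒜 ν T) :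
    InnerApprox 𝒜 ν (S ∩ T) := by
  intro ε hε
  obtain ⟨L, l1, l2, l3, l4⟩ := h1 _ (half_pos hε)
  obtain ⟨M, m1, m2, m3, m4⟩ := h2 _ (half_pos hε)
  refine ⟨L ∩ M, hA.inter_mem l1 m1, l2.inter m2, inter_subset_inter l3 m3, ?_⟩
  have a := hν.mono' hA (hA.sdiff_mem (hA.inter_mem hS hT) (hA.inter_mem l1 m1))
    (hA.union_mem (hA.sdiff_mem hS l1) (hA.sdiff_mem hT m1))
    (by intro x hx; simp only [Set.mem_sdiff, mem_union, mem_inter_iff] at hx ⊢; tauto)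
  have b := hν.union_le hA (hA.sdiff_mem hS l1) (hA.sdiff_mem hT m1)
  linarith

theorem radon_extension [CompactSpace X] [T2Space X] (hA : IsSetAlgebra 𝒜)
    (hν : IsFinAddProb 𝒜 ν)
    (hsep : ∀ C U : Set X, IsCompact C → IsOpen U → C ⊆ U → ∃ V ∈ 𝒜, IsOpen V ∧ C ⊆ V ∧ V ⊆ U)
    (hmeas : ∀ S ∈ 𝒜, MeasurableSet[borel X] S) (happ : ∀ S ∈ 𝒜, InnerApprox 𝒜 ν S) :
    ∃ lam : RadonProb X, ∀ S ∈ 𝒜, (lam.1 S).toReal = ν S := by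
  letI : MeasurableSpace X := borel X
  haveI : BorelSpace X := ⟨rfl⟩
  let c := finAddContent hA hν hsep
  have hcval : ∀ C : TopologicalSpace.Compacts X,
      c C = ENNReal.ofReal (sInf (outerVals 𝒜 ν (C : Set X))) := by
    intro C
    rfl
  have hge : ∀ L ∈ 𝒜, IsCompact L → ENNReal.ofReal (ν L) ≤ c.measure L := by
    intro L hL hLc
    rw [c.measure_apply (hmeas L hL)]
    refine le_trans ?_ (c.le_outerMeasure_compacts ⟨L, hLc⟩)
    rw [hcval]
    refine ENNReal.ofReal_le_ofReal (le_csInf (outerVals_nonempty hA _) ?_)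
    rintro r ⟨V, h1, h2, h3, rfl⟩
    exact hν.mono' hA hL h1 h3
  have huniv : c.measure univ = 1 := by
    refine le_antisymm ?_ ?_
    · rw [c.measure_apply MeasurableSet.univ]
      refine (c.outerMeasure_le ⊤ ⊤ (by simp)).trans ?_
      rw [hcval]
      refine ENNReal.ofReal_le_one.2 ?_
      rw [← hν.2.1]
      exact csInf_le (outerVals_bdd hν _)
        ⟨univ, hA.univ_mem, isOpen_univ, subset_univ _, rfl⟩
    · have := hge univ hA.univ_mem isCompact_univ
      rwa [hν.2.1, ENNReal.ofReal_one] at this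
  haveI hp : IsProbabilityMeasure c.measure := ⟨huniv⟩
  have hge2 : ∀ S ∈ 𝒜, ν S ≤ (c.measure S).toReal := by
    intro S hS
    refine le_of_forall_pos_le_add fun ε hε => ?_
    obtain ⟨L, l1, l2, l3, l4⟩ := happ S hS ε hε
    have h1 := hν.diff_add hA l1 hS l3
    have h2 : ν L ≤ (c.measure L).toReal :=
      (ENNReal.ofReal_le_iff_le_toReal (measure_ne_top _ _)).1 (hge L l1 l2)
    have h3 : (c.measure L).toReal ≤ (c.measure S).toReal :=
      ENNReal.toReal_mono (measure_ne_top _ _) (measure_mono l3)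
    linarith
  refine ⟨⟨c.measure, hp, inferInstance⟩, fun S hS => ?_⟩
  refine le_antisymm ?_ (hge2 S hS)
  have h1 := hge2 _ (hA.compl_mem hS)
  have h2 : c.measure.real S + c.measure.real Sᶜ = 1 := by
    rw [measureReal_add_measureReal_compl (hmeas S hS)]; simp [Measure.real, huniv]
  have h3 := hν.diff_add hA hS hA.univ_mem (subset_univ _)
  rw [hν.2.1, ← compl_eq_univ_sdiff] at h3
  simp only [Measure.real] at h2
  change (c.measure S).toReal ≤ ν S
  linarith

end Aux

theorem rectAlgebra_isSetAlgebra (K : Type*) [TopologicalSpace K] :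
    IsSetAlgebra (rectAlgebra K) := isSetAlgebra_generateSetAlgebra

theorem rect_mem {K : Type*} [TopologicalSpace K] {A B : Set K}
    (hA : MeasurableSet[borel K] A) (hB : MeasurableSet[borel K] B) :
    A ×ˢ B ∈ rectAlgebra K :=
  self_subset_generateSetAlgebra ⟨A, hA, B, hB, rfl⟩

theorem rectAlgebra_sep {K : Type*} [TopologicalSpace K] (C U : Set (K × K)) (hC : IsCompact C)
    (hU : IsOpen U) (h : C ⊆ U) : ∃ V ∈ rectAlgebra K, IsOpen V ∧ C ⊆ V ∧ V ⊆ U := by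
  have hop : ∀ s : Set K, IsOpen s → MeasurableSet[borel K] s :=
    fun s hs => MeasurableSpace.measurableSet_generateFrom hs
  refine hC.induction_on (p := fun C => ∃ V ∈ rectAlgebra K, IsOpen V ∧ C ⊆ V ∧ V ⊆ U)
    ⟨∅, (rectAlgebra_isSetAlgebra K).empty_mem, isOpen_empty, Subset.rfl, empty_subset _⟩ ?_ ?_ ?_
  · rintro s t hst ⟨V, h1, h2, h3, h4⟩
    exact ⟨V, h1, h2, hst.trans h3, h4⟩
  · rintro s t ⟨V, h1, h2, h3, h4⟩ ⟨W, k1, k2, k3, k4⟩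
    exact ⟨V ∪ W, (rectAlgebra_isSetAlgebra K).union_mem h1 k1, h2.union k2,
      union_subset_union h3 k3, union_subset h4 k4⟩
  · rintro ⟨x, y⟩ hxy
    obtain ⟨u, v, hu, hv, hx, hy, huv⟩ := isOpen_prod_iff.1 hU x y (h hxy)
    exact ⟨u ×ˢ v, mem_nhdsWithin_of_mem_nhds ((hu.prod hv).mem_nhds ⟨hx, hy⟩),
      u ×ˢ v, rect_mem (hop u hu) (hop v hv), hu.prod hv, Subset.rfl, huv⟩

theorem rectAlgebra_meas {K : Type*} [TopologicalSpace K] (S : Set (K × K))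
    (hS : S ∈ rectAlgebra K) : MeasurableSet[borel (K × K)] S := by
  induction hS with
  | base s hs =>
    obtain ⟨A, hA, B, hB, rfl⟩ := hs
    rw [Set.prod_eq]
    exact MeasurableSet.inter (continuous_fst.borel_measurable hA)
      (continuous_snd.borel_measurable hB)
  | empty => exact @MeasurableSet.empty _ (borel _)
  | compl s _ h => exact h.compl
  | union s t _ _ h1 h2 => exact h1.union h2

theorem rect_approx {K : Type*} [TopologicalSpace K] [CompactSpace K] [T2Space K]
    (μ : RadonProb K) (ν : Set (K × K) → ℝ) (hν : IsFinAddProb (rectAlgebra K) ν)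
    (hm : HasMarginals ν μ.1) (A B : Set K)
    (hA : MeasurableSet[borel K] A) (hB : MeasurableSet[borel K] B) :
    InnerApprox (rectAlgebra K) ν (A ×ˢ B) := by
  letI : MeasurableSpace K := borel K
  haveI : BorelSpace K := ⟨rfl⟩
  haveI := μ.2.1
  haveI := μ.2.2
  have key : ∀ A : Set K, MeasurableSet A → ∀ ε : ℝ, 0 < ε →
      ∃ F, IsCompact F ∧ F ⊆ A ∧ (μ.1 (A \ F)).toReal < ε := by
    intro A hA ε hε
    obtain ⟨F, h1, h2, h3⟩ := hA.exists_isCompact_sdiff_lt (measure_ne_top μ.1 A)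
      (ENNReal.ofReal_pos.2 hε).ne'
    exact ⟨F, h2, h1, ENNReal.toReal_lt_of_lt_ofReal h3⟩
  have hR := rectAlgebra_isSetAlgebra K
  intro ε hε
  obtain ⟨F, f1, f2, f3⟩ := key A hA _ (half_pos hε)
  obtain ⟨G, g1, g2, g3⟩ := key B hB _ (half_pos hε)
  have hF := f1.measurableSet
  have hG := g1.measurableSet
  refine ⟨F ×ˢ G, rect_mem hF hG, f1.prod g1, prod_mono f2 g2, ?_⟩
  have m1 : (A \ F) ×ˢ (univ : Set K) ∈ rectAlgebra K := rect_mem (hA.diff hF) MeasurableSet.univ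
  have m2 : (univ : Set K) ×ˢ (B \ G) ∈ rectAlgebra K := rect_mem MeasurableSet.univ (hB.diff hG)
  have a := hν.mono' hR (hR.sdiff_mem (rect_mem hA hB) (rect_mem hF hG)) (hR.union_mem m1 m2)
    (by
      rintro ⟨x, y⟩ hx
      simp only [Set.mem_sdiff, mem_union, mem_prod, mem_univ] at hx ⊢
      tauto)
  have b := hν.union_le hR m1 m2
  rw [(hm _ (hA.diff hF)).1, (hm _ (hB.diff hG)).2] at b
  linarith

theorem rectAlgebra_approx {K : Type*} [TopologicalSpace K] [CompactSpace K] [T2Space K]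
    (μ : RadonProb K) (ν : Set (K × K) → ℝ) (hν : IsFinAddProb (rectAlgebra K) ν)
    (hm : HasMarginals ν μ.1) (S : Set (K × K)) (hS : S ∈ rectAlgebra K) :
    InnerApprox (rectAlgebra K) ν S ∧ InnerApprox (rectAlgebra K) ν Sᶜ := by
  have hR := rectAlgebra_isSetAlgebra K
  have hu : MeasurableSet[borel K] (univ : Set K) := @MeasurableSet.univ _ (borel K)
  have he : MeasurableSet[borel K] (∅ : Set K) := @MeasurableSet.empty _ (borel K)
  induction hS with
  | base s hs =>
    obtain ⟨A, hA, B, hB, rfl⟩ := hs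
    refine ⟨rect_approx μ ν hν hm A B hA hB, ?_⟩
    have : (A ×ˢ B)ᶜ = Aᶜ ×ˢ (univ : Set K) ∪ (univ : Set K) ×ˢ Bᶜ := by
      ext ⟨x, y⟩
      simp only [mem_compl_iff, mem_prod, mem_union, mem_univ]
      tauto
    rw [this]
    have hA' : MeasurableSet[borel K] Aᶜ := MeasurableSet.compl hA
    have hB' : MeasurableSet[borel K] Bᶜ := MeasurableSet.compl hB
    exact InnerApprox.union hR hν (rect_mem hA' hu) (rect_mem hu hB')
      (rect_approx μ ν hν hm _ _ hA' hu) (rect_approx μ ν hν hm _ _ hu hB')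
  | empty =>
    refine ⟨?_, ?_⟩
    · simpa using rect_approx μ ν hν hm ∅ ∅ he he
    · simpa using rect_approx μ ν hν hm univ univ hu hu
  | compl s _ h => exact ⟨h.2, by rw [compl_compl]; exact h.1⟩
  | union s t hs ht h1 h2 =>
    refine ⟨InnerApprox.union hR hν hs ht h1.1 h2.1, ?_⟩
    rw [compl_union]
    exact InnerApprox.inter hR hν (hR.compl_mem hs) (hR.compl_mem ht) h1.2 h2.2

/-- Every finitely additive probability measure on the rectangle algebra
`𝓡 = Bor(K) ⊗ Bor(K)` with both marginals equal to a Radon probability measure `μ`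
extends to a Radon probability measure on `K × K`. -/
theorem stmt9 (K : Type*) [TopologicalSpace K] [CompactSpace K] [T2Space K]
    (μ : RadonProb K) (ν : Set (K × K) → ℝ)
    (hν : IsFinAddProb (rectAlgebra K) ν) (hm : HasMarginals ν μ.1) :
    ∃ lam : RadonProb (K × K), ∀ S ∈ rectAlgebra K, (lam.1 S).toReal = ν S := by
  exact radon_extension (rectAlgebra_isSetAlgebra K) hν rectAlgebra_sep rectAlgebra_meas
    (fun S hS => (rectAlgebra_approx μ ν hν hm S hS).1)
end
end
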